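/- Let p be a prime and q = p^ℓ. Let f, g ∈ F_q[x] be coprime polynomials not both lying in F_q[x^p], and set φ = f/g. Let M be the splitting field of f(x) − t·g(x) over F_q(t), let k = M ∩ F̄_q be its field of constants, let G = Gal(M : F_q(t)), N = Gal(M : k(t)), and let γ ∈ G be any element whose restriction to k is the Frobenius automorphism a ↦ a^q of k over F_q. Let H be the set of roots of f(x) − t·g(x) in M, on which G acts. Then there exists a constant C, depending only on deg f and deg g, such that whenever q ≥ C: φ is a permutation rational function of P¹(F_q) if and only if every element of the coset Nγ has exactly one fixed point in its action on H. -/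

import Mathlib

open Polynomial

noncomputable section

open scoped Classical in
/-- The self-map of `ℙ¹(F) = F ∪ {∞}` (encoded as `Option F`, with `none` = `∞`)
induced by the rational function `f/g`, where `f, g` are coprime polynomials. -/
def ratEval {F : Type} [Field F] (f g : F[X]) : Option F → Option F := fun x =>
  match x with
  | some a => if g.eval a ≠ 0 then some (f.eval a / g.eval a) else none
  | none =>
      if g.natDegree < f.natDegree then none
      else if f.natDegree < g.natDegree then some 0
      else some (f.leadingCoeff / g.leadingCoeff)

/-- The polynomial `f(x) - t·g(x)` over the rational function field `F(t)`. -/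
def fiberPoly {F : Type} [Field F] (f g : F[X]) : Polynomial (RatFunc F) :=
  f.map (algebraMap F (RatFunc F)) - Polynomial.C RatFunc.X * g.map (algebraMap F (RatFunc F))

/-- `x` in the splitting field of `f - t·g` is a "constant", i.e. algebraic over `F`
(equivalently lies in the field of constants `k = M ∩ F̄`). -/
def isConstantElem {F : Type} [Field F] (f g : F[X])
    (x : (fiberPoly f g).SplittingField) : Prop :=
  ∃ P : F[X], P ≠ 0 ∧
    P.eval₂ ((algebraMap (RatFunc F) (fiberPoly f g).SplittingField).comp
      (algebraMap F (RatFunc F))) x = 0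

/-- A submodule `N` of `K[X]^ι` of rank at most `ρ` meets the `K`-space of vectors with
coordinates of degree `< D` in dimension at most `ρ * D`. -/
theorem exists_ne_zero_map_eq_zero {K ι V : Type*} [Field K] [Finite ι]
    [AddCommGroup V] [Module K V] [Module.Finite K V]
    (Ψ : V →ₗ[K] (ι → K[X])) (N : Submodule K[X] (ι → K[X])) (ρ D : ℕ)
    (hρ : Module.rank K[X] N ≤ ρ) (hN : ∀ v, Ψ v ∈ N)
    (hD : ∀ v i, (Ψ v i).degree < D) (hlt : ρ * D < Module.finrank K V) :
    ∃ v, v ≠ 0 ∧ Ψ v = 0 := by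
  classical
  have := Fintype.ofFinite ι
  let L := FractionRing K[X]
  let φ : (ι → K[X]) →ₗ[K[X]] (ι → L) := (Algebra.linearMap K[X] L).compLeft ι
  have hφ : ∀ v i, φ v i = algebraMap K[X] L (v i) := fun v i => rfl
  let S : Submodule L (ι → L) := Submodule.span L (φ '' N)
  have hS : Module.finrank L S ≤ ρ := by
    obtain ⟨b, hbN, hbspan, hbli⟩ := exists_linearIndependent L (φ '' (N : Set (ι → K[X])))
    have hbfin : b.Finite := hbli.setFinite
    have := hbfin.fintype
    have h1 : Module.finrank L S = Fintype.card b := by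
      have : S = Submodule.span L (Set.range ((↑) : b → (ι → L))) := by
        rw [Subtype.range_coe, hbspan]
      rw [this]
      exact finrank_span_eq_card hbli
    have hlift : ∀ x : b, ∃ n : N, φ n = x := fun x => by
      obtain ⟨n, hn, hx⟩ := hbN x.2
      exact ⟨⟨n, hn⟩, hx⟩
    choose g hg using hlift
    have hli : LinearIndependent K[X] g := by
      have h2 : LinearIndependent K[X] ((↑) : b → (ι → L)) :=
        hbli.restrict_scalars (fun a b hab => by
          have : algebraMap K[X] L a = algebraMap K[X] L b := by
            simpa [Algebra.smul_def] using hab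
          exact IsFractionRing.injective K[X] L this)
      refine LinearIndependent.of_comp (φ.comp N.subtype) ?_
      convert h2 using 1
      ext1 x
      exact hg x
    have h3 := hli.cardinal_le_rank
    rw [h1]
    have h4 : (Fintype.card b : Cardinal) ≤ ρ := by
      refine le_trans ?_ (h3.trans hρ)
      simp
    exact_mod_cast h4
  let v : ι → Module.Dual L S := fun i => (LinearMap.proj i).domRestrict S
  obtain ⟨κ, a, ha, hspan, hli⟩ := exists_linearIndependent' L v
  have := Finite.of_injective a ha
  have := Fintype.ofFinite κ
  have hκ : Fintype.card κ ≤ ρ := by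
    have := hli.fintype_card_le_finrank
    rw [Subspace.dual_finrank_eq] at this
    exact this.trans hS
  have key : ∀ w ∈ N, (∀ k, w (a k) = 0) → w = 0 := by
    intro w hw h0
    ext1 i
    have hwS : φ w ∈ S := Submodule.subset_span ⟨w, hw, rfl⟩
    have hall : ∀ f ∈ Submodule.span L (Set.range (v ∘ a)), f ⟨φ w, hwS⟩ = 0 := by
      intro f hf
      induction hf using Submodule.span_induction with
      | mem f hf =>
        obtain ⟨k, rfl⟩ := hf
        change φ w (a k) = 0
        rw [hφ, h0, map_zero]
      | zero => rfl
      | add f g _ _ hf hg => simp [hf, hg]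
      | smul c f _ hf => simp [hf]
    have := hall (v i) (by rw [hspan]; exact Submodule.subset_span ⟨i, rfl⟩)
    change φ w i = 0 at this
    rw [hφ] at this
    exact (IsFractionRing.injective K[X] L) (by rw [this, Pi.zero_apply, map_zero])
  let Ψ' : V →ₗ[K] (κ → degreeLT K D) :=
    LinearMap.pi fun k => LinearMap.codRestrict (degreeLT K D)
      ((LinearMap.proj (a k)).comp Ψ) (fun w => mem_degreeLT.2 (hD w _))
  have hfin : Module.finrank K (κ → degreeLT K D) = Fintype.card κ * D := by
    rw [Module.finrank_pi_fintype]
    simp [(degreeLTEquiv K D).finrank_eq]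
  have := Module.Finite.equiv (degreeLTEquiv K D).symm
  have hker : LinearMap.ker Ψ' ≠ ⊥ :=
    LinearMap.ker_ne_bot_of_finrank_lt (by
      rw [hfin]
      exact lt_of_le_of_lt (Nat.mul_le_mul_right _ hκ) hlt)
  obtain ⟨w, hw, hw0⟩ := Submodule.exists_mem_ne_zero_of_ne_bot hker
  refine ⟨w, hw0, key _ (hN w) fun k => ?_⟩
  have := congrFun (LinearMap.mem_ker.1 hw) k
  exact congrArg Subtype.val this

/-- Vectors whose coordinates with respect to `b` are polynomials of degree `< D`. -/
def degSpace {K ι T : Type*} [Field K] [AddCommGroup T] [Module K[X] T]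
    (b : Module.Basis ι K[X] T) (D : ℕ) : AddSubgroup T where
  carrier := {v | ∀ i, (b.repr v i).degree < D}
  zero_mem' := fun i => by simp
  add_mem' := fun {v w} hv hw i => by
    simpa using (degree_add_le _ _).trans_lt (max_lt (hv i) (hw i))
  neg_mem' := fun {v} hv i => by simpa using hv i

section degSpace

variable {K ι T : Type*} [Field K] [CommRing T] [Algebra K[X] T]
  {b : Module.Basis ι K[X] T}

theorem degSpace_mono {D D' : ℕ} (h : D ≤ D') : degSpace b D ≤ degSpace b D' :=
  fun _ hv i => (hv i).trans_le (by exact_mod_cast h)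

theorem basis_mem_degSpace (i : ι) : b i ∈ degSpace b 1 := by
  classical
  intro j
  rw [b.repr_self, Finsupp.single_apply]
  split_ifs
  · simp
  · simp

theorem smul_mem_degSpace {D c : ℕ} {v : T} (hv : v ∈ degSpace b D) {r : K[X]}
    (hr : r.natDegree ≤ c) : r • v ∈ degSpace b (D + c) := by
  intro i
  rw [map_smul, Finsupp.smul_apply, smul_eq_mul]
  by_cases h : b.repr v i = 0
  · simp [h]
  have h1 := (natDegree_lt_iff_degree_lt h).2 (hv i)
  exact lt_of_le_of_lt degree_le_natDegree
    (by exact_mod_cast lt_of_le_of_lt natDegree_mul_le (by omega))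

theorem mul_mem_degSpace [Finite ι] {t : T} {c : ℕ} (ht : ∀ i, t * b i ∈ degSpace b (c + 1))
    {D : ℕ} {v : T} (hv : v ∈ degSpace b D) : t * v ∈ degSpace b (D + c) := by
  classical
  have := Fintype.ofFinite ι
  rw [← b.sum_repr v, Finset.mul_sum]
  refine sum_mem fun i _ => ?_
  rw [mul_smul_comm]
  by_cases h : b.repr v i = 0
  · simp [h, zero_mem]
  have h1 := (natDegree_lt_iff_degree_lt h).2 (hv i)
  exact degSpace_mono (by omega) (smul_mem_degSpace (ht i) le_rfl)

theorem pow_mul_mem_degSpace [Finite ι] {t : T} {c : ℕ} (ht : ∀ i, t * b i ∈ degSpace b (c + 1))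
    (k : ℕ) {D : ℕ} {v : T} (hv : v ∈ degSpace b D) : t ^ k * v ∈ degSpace b (D + c * k) := by
  induction k with
  | zero => simpa using hv
  | succ k ih =>
    rw [pow_succ', mul_assoc, mul_add, mul_one, ← add_assoc]
    exact mul_mem_degSpace ht ih

end degSpace

section auxiliary

variable {K T Λ : Type} [Field K] [CommRing T] [Algebra K[X] T] [CommRing Λ] [Algebra K[X] Λ]

theorem rank_range_mulLeft_le {d M : ℕ}
    (b : Module.Basis (Fin d × Fin M × Fin d) K[X] T) (θ : T) (τ : T →ₐ[K[X]] Λ)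
    (hτ : τ θ = 0) (z : Fin d × Fin M → T) (hz : LinearIndependent K[X] (τ ∘ z)) :
    Module.rank K[X] (LinearMap.range (LinearMap.mulLeft K[X] θ)) ≤ (d * (d - 1) * M : ℕ) := by
  let N := LinearMap.range (LinearMap.mulLeft K[X] θ)
  have h1 := rank_quotient_add_rank_of_isDomain N
  have h2 : Module.rank K[X] T = (d * (M * d) : ℕ) := by
    rw [rank_eq_card_basis b]; simp
  have hN : N ≤ LinearMap.ker τ.toLinearMap := by
    rintro _ ⟨v, rfl⟩
    simp [hτ]
  have h3 : ((d * M : ℕ) : Cardinal) ≤ Module.rank K[X] (T ⧸ N) := by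
    have : LinearIndependent K[X] (N.mkQ ∘ z) := by
      exact LinearIndependent.of_comp (N.liftQ τ.toLinearMap hN) hz
    simpa using this.cardinal_le_rank
  rw [h2] at h1
  have h4 : Module.rank K[X] (T ⧸ N) < Cardinal.aleph0 :=
    lt_of_le_of_lt (h1 ▸ le_self_add) (Cardinal.natCast_lt_aleph0)
  have h5 : Module.rank K[X] N < Cardinal.aleph0 :=
    lt_of_le_of_lt (h1 ▸ le_add_self) (Cardinal.natCast_lt_aleph0)
  obtain ⟨a, ha⟩ := Cardinal.lt_aleph0.1 h4
  obtain ⟨e, he⟩ := Cardinal.lt_aleph0.1 h5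
  change Module.rank K[X] N ≤ _
  rw [ha, he] at h1
  rw [ha] at h3
  rw [he]
  norm_cast at h1 h3 ⊢
  have h6 : d * (d - 1) * M + d * M = d * (M * d) := by
    rcases d with _ | d
    · simp
    · simp; ring
  omega

/-- The value at a point of the polynomial in four variables with coefficients `G`. -/
def evalForm {K R : Type*} [CommSemiring K] [CommSemiring R] [Algebra K R] {l m d : ℕ}
    (x y x' y' : R) (G : Fin l × Fin d × Fin m × Fin d → K) : R :=
  ∑ s, G s • (x ^ (s.1 : ℕ) * y ^ (s.2.1 : ℕ) * (x' ^ (s.2.2.1 : ℕ) * y' ^ (s.2.2.2 : ℕ)))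

theorem exists_evalForm_eq_zero [Algebra K T] [IsScalarTower K K[X] T] {d M c l m : ℕ} (hM : 0 < M)
    (b : Module.Basis (Fin d × Fin M × Fin d) K[X] T) (y u y' : T)
    (hb : ∀ s, b s = y ^ (s.1 : ℕ) * u ^ (s.2.1 : ℕ) * y' ^ (s.2.2 : ℕ))
    (hy : ∀ s, y * b s ∈ degSpace b (c + 1)) (hy' : ∀ s, y' * b s ∈ degSpace b (c + 1))
    (hu : ∀ s, u * b s ∈ degSpace b (1 + 1))
    (τ : T →ₐ[K[X]] Λ) (hτ : τ ((y - y') ^ M) = 0)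
    (hz : LinearIndependent K[X] (fun s : Fin d × Fin M => τ (y ^ (s.1 : ℕ) * u ^ (s.2 : ℕ))))
    (hlt : d * (d - 1) * M * (l + m + c * M) < l * (d * (m * d))) :
    ∃ G : Fin l × Fin d × Fin m × Fin d → K, G ≠ 0 ∧
      (y - y') ^ M * evalForm (algebraMap K[X] T X) y (algebraMap K[X] T X + u) y' G = 0 := by
  let Φ : (Fin l × Fin d × Fin m × Fin d → K) →ₗ[K] T :=
    { toFun := fun G => (y - y') ^ M *
        evalForm (algebraMap K[X] T X) y (algebraMap K[X] T X + u) y' G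
      map_add' := fun G G' => by
        simp only [evalForm, Pi.add_apply, add_smul, Finset.sum_add_distrib, mul_add]
      map_smul' := fun a G => by
        simp only [evalForm, Pi.smul_apply, smul_eq_mul, mul_smul, ← Finset.smul_sum,
          mul_smul_comm, RingHom.id_apply] }
  let Ψ : (Fin l × Fin d × Fin m × Fin d → K) →ₗ[K] (Fin d × Fin M × Fin d → K[X]) :=
    (b.equivFun.toLinearMap.restrictScalars K).comp Φ
  let N : Submodule K[X] T := LinearMap.range (LinearMap.mulLeft K[X] ((y - y') ^ M))
  have hrank := rank_range_mulLeft_le b ((y - y') ^ M) τ hτ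
    (fun s : Fin d × Fin M => y ^ (s.1 : ℕ) * u ^ (s.2 : ℕ)) hz
  have hD : ∀ G s, (Ψ G s).degree < (l + m + c * M : ℕ) := by
    intro G
    change Φ G ∈ degSpace b (l + m + c * M)
    have ht : ∀ s, (y - y') * b s ∈ degSpace b (c + 1) := fun s => by
      rw [sub_mul]; exact sub_mem (hy s) (hy' s)
    refine pow_mul_mem_degSpace ht M (sum_mem fun s _ => ?_)
    have hx' : ∀ s, (algebraMap K[X] T X + u) * b s ∈ degSpace b (1 + 1) := fun s => by
      rw [add_mul, ← Algebra.smul_def]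
      exact add_mem (smul_mem_degSpace (basis_mem_degSpace s) (by simp)) (hu s)
    have h1 : G s • (algebraMap K[X] T X ^ (s.1 : ℕ) * y ^ (s.2.1 : ℕ) *
          ((algebraMap K[X] T X + u) ^ (s.2.2.1 : ℕ) * y' ^ (s.2.2.2 : ℕ))) =
        (C (G s) * X ^ (s.1 : ℕ)) • ((algebraMap K[X] T X + u) ^ (s.2.2.1 : ℕ) *
          b (s.2.1, ⟨0, hM⟩, s.2.2.2)) := by
      rw [hb, Algebra.smul_def (C (G s) * X ^ (s.1 : ℕ)), map_mul, map_pow, Algebra.smul_def,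
        IsScalarTower.algebraMap_apply K K[X] T]
      simp only [pow_zero, algebraMap_eq]
      ring
    rw [h1]
    have h2 := smul_mem_degSpace (pow_mul_mem_degSpace hx' (s.2.2.1 : ℕ)
      (basis_mem_degSpace (b := b) (s.2.1, ⟨0, hM⟩, s.2.2.2)))
      (natDegree_C_mul_X_pow_le (G s) (s.1 : ℕ))
    have := s.1.2
    have := s.2.2.1.2
    exact degSpace_mono (by omega) h2
  obtain ⟨G, hG, hG0⟩ := exists_ne_zero_map_eq_zero Ψ (N.map b.equivFun.toLinearMap)
    (d * (d - 1) * M) (l + m + c * M)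
    ((b.equivFun.submoduleMap N).rank_eq.symm.trans_le hrank)
    (fun G => ⟨Φ G, ⟨_, rfl⟩, rfl⟩) hD (by
      rw [Module.finrank_fintype_fun_eq_card]
      simpa using hlt)
  refine ⟨G, hG, ?_⟩
  exact b.equivFun.map_eq_zero_iff.1 hG0

end auxiliary

section universal

variable {K : Type} [Field K]

/-- The `K`-algebra homomorphism `K[X] → S` sending `X` to `X + u`. -/
def shiftHom {S : Type} [CommRing S] [Algebra K S] [Algebra K[X] S] (u : S) : K[X] →+* S :=
  eval₂RingHom (algebraMap K S) (algebraMap K[X] S X + u)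

theorem comp_shiftHom {S S' : Type} [CommRing S] [Algebra K S] [Algebra K[X] S]
    [IsScalarTower K K[X] S] [CommRing S'] [Algebra K S'] [Algebra K[X] S']
    [IsScalarTower K K[X] S'] (τ : S →ₐ[K[X]] S') (u : S) :
    (τ : S →+* S').comp (shiftHom u : K[X] →+* S) = shiftHom (τ u) := by
  refine Polynomial.ringHom_ext (fun a => ?_) ?_
  · simp only [shiftHom, RingHom.comp_apply, coe_eval₂RingHom, eval₂_C]
    rw [IsScalarTower.algebraMap_apply K K[X] S, IsScalarTower.algebraMap_apply K K[X] S']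
    exact τ.commutes _
  · simp [shiftHom]

theorem shiftHom_zero {S : Type} [CommRing S] [Algebra K S] [Algebra K[X] S]
    [IsScalarTower K K[X] S] : shiftHom (0 : S) = algebraMap K[X] S := by
  refine Polynomial.ringHom_ext (fun a => ?_) ?_
  · simp only [shiftHom, coe_eval₂RingHom, eval₂_C]
    rw [IsScalarTower.algebraMap_apply K K[X] S]; rfl
  · simp [shiftHom]

theorem map_eval₂_shiftHom {S S' : Type} [CommRing S] [Algebra K S] [Algebra K[X] S]
    [IsScalarTower K K[X] S] [CommRing S'] [Algebra K S'] [Algebra K[X] S']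
    [IsScalarTower K K[X] S'] (τ : S →ₐ[K[X]] S') (u y : S) (h : K[X][X]) :
    τ (eval₂ (shiftHom u) y h) = eval₂ (shiftHom (τ u)) (τ y) h := by
  rw [← comp_shiftHom]
  exact hom_eval₂ h (shiftHom u) (τ : S →+* S') y

theorem exists_adjoin {R : Type} [CommRing R] {p : R[X]} (hp : p.Monic) {d : ℕ}
    (hd : p.natDegree = d) :
    ∃ (T : Type) (_ : CommRing T) (_ : Algebra R T) (y : T) (b : Module.Basis (Fin d) R T),
      (∀ i, b i = y ^ (i : ℕ)) ∧ eval₂ (algebraMap R T) y p = 0 ∧ (Prime p → IsDomain T) ∧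
      ∀ (S : Type) [CommRing S] (α : R →+* S) (y₁ : S), eval₂ α y₁ p = 0 →
        ∃ τ : T →+* S, τ.comp (algebraMap R T) = α ∧ τ y = y₁ := by
  subst hd
  refine ⟨AdjoinRoot p, inferInstance, inferInstance, AdjoinRoot.root p,
    (AdjoinRoot.powerBasis' hp).basis, fun i => ?_, AdjoinRoot.eval₂_root p,
    AdjoinRoot.isDomain_of_prime, fun S _ α y₁ h =>
      ⟨AdjoinRoot.lift α y₁ h, AdjoinRoot.lift_comp_of h, AdjoinRoot.lift_root h⟩⟩
  exact (congrFun (PowerBasis.coe_basis (AdjoinRoot.powerBasis' hp)) i).trans rfl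

theorem exists_universal {h : K[X][X]} (hh : h.Monic) (hd : 0 < h.natDegree) {M : ℕ} (hM : 0 < M) :
    ∃ (T : Type) (_ : CommRing T) (_ : Algebra K T) (_ : Algebra K[X] T)
      (_ : IsScalarTower K K[X] T) (y u y' : T)
      (b : Module.Basis (Fin h.natDegree × Fin M × Fin h.natDegree) K[X] T),
      (∀ s, b s = y ^ (s.1 : ℕ) * u ^ (s.2.1 : ℕ) * y' ^ (s.2.2 : ℕ)) ∧
      u ^ M = 0 ∧ aeval y h = 0 ∧ eval₂ (shiftHom u) y' h = 0 ∧
      ∀ (S : Type) [CommRing S] [Algebra K S] [Algebra K[X] S] [IsScalarTower K K[X] S]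
        (y₁ u₁ y₁' : S), u₁ ^ M = 0 → aeval y₁ h = 0 → eval₂ (shiftHom u₁) y₁' h = 0 →
        ∃ τ : T →ₐ[K[X]] S, τ y = y₁ ∧ τ u = u₁ ∧ τ y' = y₁' := by
  obtain ⟨T₁, _, _, y, b₁, hb₁, e₁, -, lift₁⟩ := exists_adjoin hh rfl
  have : Nontrivial T₁ := ⟨_, _, b₁.ne_zero ⟨0, hd⟩⟩
  obtain ⟨T₂, _, _, u, b₂, hb₂, e₂, -, lift₂⟩ :=
    exists_adjoin (monic_X_pow (R := T₁) M) (natDegree_X_pow M)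
  have : Nontrivial T₂ := ⟨_, _, b₂.ne_zero ⟨0, hM⟩⟩
  let _ : Algebra K[X] T₂ := ((algebraMap T₁ T₂).comp (algebraMap K[X] T₁)).toAlgebra
  let _ : Algebra K T₂ := ((algebraMap K[X] T₂).comp C).toAlgebra
  have : IsScalarTower K[X] T₁ T₂ := IsScalarTower.of_algebraMap_eq' rfl
  have : IsScalarTower K K[X] T₂ := IsScalarTower.of_algebraMap_eq' rfl
  obtain ⟨T, _, _, y', b₃, hb₃, e₃, -, lift₃⟩ :=
    exists_adjoin (hh.map (shiftHom u)) (hh.natDegree_map _)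
  let _ : Algebra K[X] T := ((algebraMap T₂ T).comp (algebraMap K[X] T₂)).toAlgebra
  let _ : Algebra K T := ((algebraMap K[X] T).comp C).toAlgebra
  have : IsScalarTower K[X] T₂ T := IsScalarTower.of_algebraMap_eq' rfl
  have : IsScalarTower K K[X] T := IsScalarTower.of_algebraMap_eq' rfl
  have hu : u ^ M = 0 := by simpa using e₂
  refine ⟨T, inferInstance, inferInstance, inferInstance, inferInstance,
    algebraMap T₂ T (algebraMap T₁ T₂ y), algebraMap T₂ T u, y',
    ((b₁.smulTower b₂).smulTower b₃).reindex (Equiv.prodAssoc _ _ _), ?_, ?_, ?_, ?_, ?_⟩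
  · rintro ⟨i, j, k⟩
    simp only [Module.Basis.reindex_apply, Equiv.prodAssoc_symm_apply, Module.Basis.smulTower_apply,
      hb₁, hb₂, hb₃, Algebra.smul_def, map_mul, map_pow]
  · rw [← map_pow, hu, map_zero]
  · rw [aeval_algebraMap_apply, aeval_algebraMap_apply, aeval_def, e₁, map_zero, map_zero]
  · rw [eval₂_map] at e₃
    have h2 := comp_shiftHom (K := K) (IsScalarTower.toAlgHom K[X] T₂ T) u
    exact (congrArg (fun f => eval₂ f _ h) h2).symm.trans e₃
  · intro S _ _ _ _ y₁ u₁ y₁' hu hy hy'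
    obtain ⟨τ₁, h₁, h₁'⟩ := lift₁ S (algebraMap K[X] S) y₁ hy
    obtain ⟨τ₂, h₂, h₂'⟩ := lift₂ S τ₁ u₁ (by simpa using hu)
    have h₄ : τ₂.comp (algebraMap K[X] T₂) = algebraMap K[X] S := by
      rw [IsScalarTower.algebraMap_eq K[X] T₁ T₂, ← RingHom.comp_assoc, h₂, h₁]
    let τ₂' : T₂ →ₐ[K[X]] S := ⟨τ₂, fun r => RingHom.congr_fun h₄ r⟩
    obtain ⟨τ₃, h₃, h₃'⟩ := lift₃ S τ₂ y₁' (by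
      have := comp_shiftHom τ₂' u
      change τ₂.comp _ = shiftHom (τ₂ u) at this
      rw [eval₂_map, this, h₂', hy'])
    have h₅ : τ₃.comp (algebraMap K[X] T) = algebraMap K[X] S := by
      rw [IsScalarTower.algebraMap_eq K[X] T₂ T, ← RingHom.comp_assoc, h₃, h₄]
    refine ⟨⟨τ₃, fun r => RingHom.congr_fun h₅ r⟩, ?_, ?_, h₃'⟩
    · change τ₃.comp (algebraMap T₂ T) _ = _
      rw [h₃]
      change τ₂.comp (algebraMap T₁ T₂) _ = _
      rw [h₂, h₁']
    · change τ₃.comp (algebraMap T₂ T) _ = _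
      rw [h₃, h₂']

end universal

section form

variable {K : Type} [Field K]

theorem eval₂_monic_eq {R S : Type} [CommRing R] [CommRing S] (α : R →+* S) {h : R[X]}
    (hh : h.Monic) {d : ℕ} (hd : h.natDegree = d) {y : S} (hy : eval₂ α y h = 0) :
    y ^ d = -∑ i ∈ Finset.range d, α (h.coeff i) * y ^ i := by
  subst hd
  rw [eval₂_eq_sum_range, Finset.sum_range_succ, hh.coeff_natDegree, map_one, one_mul] at hy
  exact eq_neg_of_add_eq_zero_right hy

section table

variable {T : Type} [CommRing T] [Algebra K[X] T]
  {d M c : ℕ} {b : Module.Basis (Fin d × Fin M × Fin d) K[X] T} {y u y' : T}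

theorem mul_mem_degSpace_of_pow_eq_zero
    (hb : ∀ s, b s = y ^ (s.1 : ℕ) * u ^ (s.2.1 : ℕ) * y' ^ (s.2.2 : ℕ))
    (huM : u ^ M = 0) (s) :
    u * b s ∈ degSpace b (1 + 1) := by
  obtain ⟨i, j, k⟩ := s
  by_cases hj : (j : ℕ) + 1 < M
  · have : u * b (i, j, k) = b (i, ⟨j + 1, hj⟩, k) := by
      rw [hb, hb]; ring
    rw [this]
    exact degSpace_mono (by omega) (basis_mem_degSpace _)
  · have hj' : (j : ℕ) + 1 = M := by omega
    have : u * b (i, j, k) = 0 := by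
      rw [hb]
      calc _ = y ^ (i : ℕ) * u ^ ((j : ℕ) + 1) * y' ^ (k : ℕ) := by ring
        _ = 0 := by rw [hj', huM]; ring
    rw [this]
    exact zero_mem _

theorem mul_mem_degSpace_of_aeval
    (hb : ∀ s, b s = y ^ (s.1 : ℕ) * u ^ (s.2.1 : ℕ) * y' ^ (s.2.2 : ℕ))
    {h : K[X][X]} (hh : h.Monic) (hd : h.natDegree = d)
    (hc : ∀ i, (h.coeff i).natDegree ≤ c) (hy : aeval y h = 0) (s) :
    y * b s ∈ degSpace b (c + 1) := by
  obtain ⟨i, j, k⟩ := s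
  by_cases hi : (i : ℕ) + 1 < d
  · have : y * b (i, j, k) = b (⟨i + 1, hi⟩, j, k) := by
      rw [hb, hb]; ring
    rw [this]
    exact degSpace_mono (by omega) (basis_mem_degSpace _)
  · have hi' : (i : ℕ) + 1 = d := by omega
    have h1 := eval₂_monic_eq _ hh hd hy
    have : y * b (i, j, k) = -∑ r : Fin d, h.coeff r • b (r, j, k) := by
      calc y * b (i, j, k) = y ^ ((i : ℕ) + 1) * (u ^ (j : ℕ) * y' ^ (k : ℕ)) := by rw [hb]; ring
        _ = _ := by
          rw [hi', h1, neg_mul, Finset.sum_mul, ← Fin.sum_univ_eq_sum_range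
            (fun r => (Algebra.ofId K[X] T : K[X] →+* T) (h.coeff r) * y ^ r *
              (u ^ (j : ℕ) * y' ^ (k : ℕ)))]
          simp only [hb, Algebra.smul_def, mul_assoc]
          rfl
    rw [this]
    exact neg_mem (sum_mem fun r _ => degSpace_mono (by omega)
      (smul_mem_degSpace (basis_mem_degSpace _) (hc r)))

variable [Algebra K T] [IsScalarTower K K[X] T]

theorem shiftHom_mul_mem_degSpace (hu : ∀ s, u * b s ∈ degSpace b (1 + 1)) {p : K[X]}
    (hp : p.natDegree ≤ c) (s) : shiftHom u p * b s ∈ degSpace b (c + 1) := by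
  have hx' : ∀ s, (algebraMap K[X] T X + u) * b s ∈ degSpace b (1 + 1) := fun s => by
    rw [add_mul, ← Algebra.smul_def]
    exact add_mem (smul_mem_degSpace (basis_mem_degSpace s) (by simp)) (hu s)
  have e : shiftHom u p = ∑ i ∈ Finset.range (p.natDegree + 1),
      algebraMap K T (p.coeff i) * (algebraMap K[X] T X + u) ^ i :=
    eval₂_eq_sum_range _ _
  rw [e, Finset.sum_mul]
  refine sum_mem fun i hi => ?_
  rw [mul_assoc, IsScalarTower.algebraMap_apply K K[X] T, ← Algebra.smul_def]
  have h1 := smul_mem_degSpace (c := 0) (pow_mul_mem_degSpace hx' i (basis_mem_degSpace s))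
    (r := algebraMap K K[X] (p.coeff i)) (by simp)
  have := Finset.mem_range.1 hi
  exact degSpace_mono (by omega) h1

theorem mul_mem_degSpace_of_eval₂
    (hb : ∀ s, b s = y ^ (s.1 : ℕ) * u ^ (s.2.1 : ℕ) * y' ^ (s.2.2 : ℕ))
    (hu : ∀ s, u * b s ∈ degSpace b (1 + 1))
    {h : K[X][X]} (hh : h.Monic) (hd : h.natDegree = d)
    (hc : ∀ i, (h.coeff i).natDegree ≤ c) (hy : eval₂ (shiftHom u) y' h = 0) (s) :
    y' * b s ∈ degSpace b (c + 1) := by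
  obtain ⟨i, j, k⟩ := s
  by_cases hk : (k : ℕ) + 1 < d
  · have : y' * b (i, j, k) = b (i, j, ⟨k + 1, hk⟩) := by
      rw [hb, hb]; ring
    rw [this]
    exact degSpace_mono (by omega) (basis_mem_degSpace _)
  · have hk' : (k : ℕ) + 1 = d := by omega
    have h1 := eval₂_monic_eq _ hh hd hy
    have : y' * b (i, j, k) = -∑ r : Fin d, shiftHom u (h.coeff r) * b (i, j, r) := by
      calc y' * b (i, j, k) = y' ^ ((k : ℕ) + 1) * (y ^ (i : ℕ) * u ^ (j : ℕ)) := by rw [hb]; ring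
        _ = _ := by
          rw [hk', h1, neg_mul, Finset.sum_mul, ← Fin.sum_univ_eq_sum_range
            (fun r => shiftHom u (h.coeff r) * y' ^ r * (y ^ (i : ℕ) * u ^ (j : ℕ)))]
          simp only [hb]
          congr 1
          exact Finset.sum_congr rfl fun r _ => by ring
    rw [this]
    exact neg_mem (sum_mem fun r _ => shiftHom_mul_mem_degSpace hu (hc r) _)

end table

/-- Newton lifting of a simple root of `h` along `x ↦ x + u`. -/
theorem exists_newton {E : Type} [Field E] [Algebra K E] [Algebra K[X] E]
    [IsScalarTower K K[X] E] {h : K[X][X]} {y₀ : E} (hy₀ : aeval y₀ h = 0)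
    (hy₀' : aeval y₀ (derivative h) ≠ 0) {M : ℕ} (hM : 0 < M) :
    ∃ (Λ : Type) (_ : CommRing Λ) (_ : Algebra E Λ) (u : Λ) (b : Module.Basis (Fin M) E Λ)
      (_ : Algebra K Λ) (_ : Algebra K[X] Λ) (_ : IsScalarTower K K[X] Λ)
      (_ : IsScalarTower K[X] E Λ) (y' : Λ), (∀ i, b i = u ^ (i : ℕ)) ∧ u ^ M = 0 ∧
      eval₂ (shiftHom u) y' h = 0 ∧ (algebraMap E Λ y₀ - y') ^ M = 0 := by
  obtain ⟨Λ, _, _, u, b, hb, e, -, lift⟩ :=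
    exists_adjoin (monic_X_pow (R := E) M) (natDegree_X_pow M)
  have hu : u ^ M = 0 := by simpa using e
  let _ : Algebra K Λ := ((algebraMap E Λ).comp (algebraMap K E)).toAlgebra
  let _ : Algebra K[X] Λ := ((algebraMap E Λ).comp (algebraMap K[X] E)).toAlgebra
  have : IsScalarTower K[X] E Λ := IsScalarTower.of_algebraMap_eq' rfl
  have : IsScalarTower K K[X] Λ := IsScalarTower.of_algebraMap_eq' (by
    change (algebraMap E Λ).comp _ = (algebraMap E Λ).comp ((algebraMap K[X] E).comp _)
    rw [IsScalarTower.algebraMap_eq K K[X] E])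
  have : IsScalarTower K E Λ := IsScalarTower.of_algebraMap_eq' rfl
  obtain ⟨ψ, hψ, hψu⟩ := lift E (RingHom.id E) 0 (by simp [hM.ne'])
  have hψ' : ∀ a, ψ (algebraMap E Λ a) = a := fun a => RingHom.congr_fun hψ a
  have hdec : ∀ v : Λ, ∃ w, v = algebraMap E Λ (ψ v) + u * w := by
    intro v
    have : ∃ a w, v = algebraMap E Λ a + u * w := by
      rw [← b.sum_repr v]
      refine Finset.sum_induction _ (fun v => ∃ a w, v = algebraMap E Λ a + u * w) ?_ ?_ ?_
      · rintro _ _ ⟨a, w, rfl⟩ ⟨a', w', rfl⟩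
        exact ⟨a + a', w + w', by rw [map_add]; ring⟩
      · exact ⟨0, 0, by simp⟩
      · rintro ⟨i, hi⟩ -
        rw [hb, Algebra.smul_def]
        rcases i with _ | i
        · exact ⟨b.repr v ⟨0, hi⟩, 0, by simp⟩
        · exact ⟨0, algebraMap E Λ (b.repr v ⟨i + 1, hi⟩) * u ^ i, by
            rw [map_zero]; ring⟩
    obtain ⟨a, w, hv⟩ := this
    refine ⟨w, ?_⟩
    have : ψ v = a := by rw [hv, map_add, map_mul, hψu, hψ']; ring
    rwa [this]
  have hnil : ∀ v : Λ, ψ v = 0 → v ^ M = 0 := fun v hv => by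
    obtain ⟨w, hw⟩ := hdec v
    rw [hw, hv, map_zero, zero_add, mul_pow, hu, zero_mul]
  have hunit : ∀ v : Λ, ψ v ≠ 0 → IsUnit v := fun v hv => by
    obtain ⟨w, hw⟩ := hdec v
    rw [hw]
    refine IsNilpotent.isUnit_add_left_of_commute ⟨M, by rw [mul_pow, hu, zero_mul]⟩
      ((isUnit_iff_ne_zero.2 hv).map _) (Commute.all _ _)
  have hψshift : ψ.comp (shiftHom u) = algebraMap K[X] E := by
    rw [← shiftHom_zero]
    refine Polynomial.ringHom_ext (fun a => ?_) ?_
    · simp only [shiftHom, RingHom.comp_apply, coe_eval₂RingHom, eval₂_C]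
      exact hψ' _
    · simp only [shiftHom, RingHom.comp_apply, coe_eval₂RingHom, eval₂_X, map_add, hψu]
      rw [IsScalarTower.algebraMap_apply K[X] E Λ, hψ']
  let P : Λ[X] := h.map (shiftHom u)
  have hψP : ∀ (Q : K[X][X]) (v : Λ), ψ (aeval v (Q.map (shiftHom u))) = aeval (ψ v) Q := by
    intro Q v
    rw [aeval_def, Algebra.algebraMap_self, eval₂_map, RingHom.id_comp, hom_eval₂, hψshift,
      aeval_def]
  obtain ⟨y', ⟨h1, h2⟩, -⟩ := existsUnique_nilpotent_sub_and_aeval_eq_zero (P := P)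
    (x := algebraMap E Λ y₀) ⟨M, hnil _ (by rw [hψP, hψ', hy₀])⟩
    (hunit _ (by rw [derivative_map, hψP, hψ']; exact hy₀'))
  refine ⟨Λ, inferInstance, inferInstance, u, b, inferInstance, inferInstance, inferInstance,
    inferInstance, y', hb, hu, ?_, hnil _ (h1.map ψ).eq_zero⟩
  rwa [aeval_def, Algebra.algebraMap_self, eval₂_map, RingHom.id_comp] at h2

theorem exists_form {E : Type} [Field E] [Algebra K E] [Algebra K[X] E]
    [IsScalarTower K K[X] E] {h : K[X][X]} (hh : h.Monic) {d : ℕ} (hd : h.natDegree = d)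
    (hd0 : 0 < d) {c : ℕ} (hc : ∀ i, (h.coeff i).natDegree ≤ c)
    {y₀ : E} (hy₀ : aeval y₀ h = 0) (hy₀' : aeval y₀ (derivative h) ≠ 0)
    (hli : LinearIndependent K[X] fun i : Fin d => y₀ ^ (i : ℕ)) {M l m : ℕ} (hM : 0 < M)
    (hlt : d * (d - 1) * M * (l + m + c * M) < l * (d * (m * d))) :
    ∃ G : Fin l × Fin d × Fin m × Fin d → K, G ≠ 0 ∧
      ∀ (S : Type) [CommRing S] [Algebra K S] [Algebra K[X] S] [IsScalarTower K K[X] S]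
        (y u y' : S), u ^ M = 0 → aeval y h = 0 → eval₂ (shiftHom u) y' h = 0 →
        (y - y') ^ M * evalForm (algebraMap K[X] S X) y (algebraMap K[X] S X + u) y' G = 0 := by
  subst hd
  obtain ⟨T, _, _, _, _, y, u, y', b, hb, hu, hy, hy', lift⟩ := exists_universal hh hd0 hM
  obtain ⟨Λ, _, _, u₁, b₁, _, _, _, _, y₁', hb₁, hu₁, hy₁', hy₁⟩ := exists_newton hy₀ hy₀' hM
  obtain ⟨τ, h1, h2, h3⟩ := lift Λ (algebraMap E Λ y₀) u₁ y₁' hu₁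
    (by rw [aeval_algebraMap_apply, hy₀, map_zero]) hy₁'
  have hub := mul_mem_degSpace_of_pow_eq_zero hb hu
  obtain ⟨G, hG, hG0⟩ := exists_evalForm_eq_zero (l := l) (m := m) hM b y u y' hb
    (mul_mem_degSpace_of_aeval hb hh rfl hc hy)
    (mul_mem_degSpace_of_eval₂ hb hub hh rfl hc hy') hub τ
    (by rw [map_pow, map_sub, h1, h3, hy₁])
    (by
      convert linearIndependent_smul hli b₁.linearIndependent with s
      rw [map_mul, map_pow, map_pow, h1, h2, hb₁, Algebra.smul_def, map_pow]) hlt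
  refine ⟨G, hG, fun S _ _ _ _ y₂ u₂ y₂' hu₂ hy₂ hy₂' => ?_⟩
  obtain ⟨σ, e1, e2, e3⟩ := lift S y₂ u₂ y₂' hu₂ hy₂ hy₂'
  have hsmul : ∀ (a : K) (t : T), σ (a • t) = a • σ t := fun a t => by
    rw [← algebraMap_smul K[X] a t, map_smul, algebraMap_smul]
  have := congrArg σ hG0
  simpa only [evalForm, map_mul, map_pow, map_sub, map_sum, hsmul, map_add, AlgHom.commutes, e1, e2,
    e3, map_zero] using this

end form

section independence

variable {K : Type} [Field K]

/-- If every constant of `E` lies in `K`, then irreducibility of a bivariate polynomial persists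
after extending scalars from `K` to `E`. -/
theorem irreducible_map_mapRingHom {E : Type} [Field E] [Algebra K E]
    (hconst : ∀ e : E, IsIntegral K e → e ∈ (algebraMap K E).range) {h : K[X][X]}
    (hh : h.Monic) (hirr : Irreducible h) :
    Irreducible (h.map (mapRingHom (algebraMap K E))) := by
  have hinj : Function.Injective (mapRingHom (algebraMap K E)) := by
    rw [coe_mapRingHom]
    exact map_injective _ (algebraMap K E).injective
  have hlift : ∀ f : E[X][X], f.Monic → f ∣ h.map (mapRingHom (algebraMap K E)) →
      ∃ f₀ : K[X][X], f₀.map (mapRingHom (algebraMap K E)) = f := by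
    intro f hf hdvd
    let _ := Polynomial.algebra K E
    rw [← mem_lifts, lifts_iff_coeff_lifts]
    intro n
    have h1 : IsIntegral K[X] (f.coeff n) := isIntegral_coeff_of_dvd h f hh hf hdvd n
    rw [isIntegral_iff_isIntegral_coeff] at h1
    have h2 : f.coeff n ∈ lifts (algebraMap K E) := by
      rw [lifts_iff_coeff_lifts]
      exact fun m => hconst _ (h1 m)
    exact (mem_lifts _).1 h2
  have key := (hh.irreducible_iff_natDegree'.1 hirr).2
  rw [(hh.map _).irreducible_iff_natDegree']
  refine ⟨fun h1 => hirr.1 ?_, fun f g hf hg hfg => ?_⟩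
  · rw [show h = 1 from map_injective _ hinj (by rw [h1, Polynomial.map_one])]
    exact isUnit_one
  · obtain ⟨f₀, rfl⟩ := hlift f hf ⟨g, hfg.symm⟩
    obtain ⟨g₀, rfl⟩ := hlift g hg ⟨_, by rw [mul_comm, hfg]⟩
    rw [← Polynomial.map_mul] at hfg
    have := key f₀ g₀ (monic_of_injective hinj hf) (monic_of_injective hinj hg)
      (map_injective _ hinj hfg)
    rwa [(monic_of_injective hinj hg).natDegree_map, hh.natDegree_map]

theorem root_mul_mem_degSpace {E B : Type} [Field E] [CommRing B] [Algebra E[X] B] {d c : ℕ}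
    {b : Module.Basis (Fin d) E[X] B} {y : B} (hb : ∀ i, b i = y ^ (i : ℕ)) {h : E[X][X]}
    (hh : h.Monic) (hd : h.natDegree = d) (hc : ∀ i, (h.coeff i).natDegree ≤ c)
    (hy : eval₂ (algebraMap E[X] B) y h = 0) (i : Fin d) : y * b i ∈ degSpace b (c + 1) := by
  by_cases hi : (i : ℕ) + 1 < d
  · have : y * b i = b ⟨i + 1, hi⟩ := by rw [hb, hb]; ring
    rw [this]
    exact degSpace_mono (by omega) (basis_mem_degSpace _)
  · have hi' : (i : ℕ) + 1 = d := by omega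
    have h1 := eval₂_monic_eq _ hh hd hy
    have : y * b i = -∑ r : Fin d, h.coeff r • b r := by
      rw [hb, ← pow_succ', hi', h1, ← Fin.sum_univ_eq_sum_range
        (fun r => algebraMap E[X] B (h.coeff r) * y ^ r)]
      simp only [hb, Algebra.smul_def]
    rw [this]
    exact neg_mem (sum_mem fun r _ => degSpace_mono (by omega)
      (smul_mem_degSpace (basis_mem_degSpace _) (hc r)))

/-- An element with coordinates of bounded degree has a nonzero multiple in the base ring of
bounded degree, namely its norm. -/
theorem exists_mul_eq_algebraMap {E B : Type} [Field E] [CommRing B] [IsDomain B] [Algebra E[X] B]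
    {d c : ℕ} (b : Module.Basis (Fin d) E[X] B) {g : B} (hg : g ≠ 0)
    (hgb : ∀ i, g * b i ∈ degSpace b (c + 1)) :
    ∃ ρ : E[X], ρ ≠ 0 ∧ ρ.natDegree ≤ d * c ∧ ∃ w : B, algebraMap E[X] B ρ = g * w := by
  have := Module.Free.of_basis b
  have := Module.Finite.of_basis b
  refine ⟨Algebra.norm E[X] g, Algebra.norm_ne_zero_iff.2 hg, ?_, ?_⟩
  · rw [Algebra.norm_eq_matrix_det b, Matrix.det_apply]
    refine natDegree_sum_le_of_forall_le _ _ fun σ _ => ?_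
    refine (natDegree_smul_le _ _).trans ((natDegree_prod_le _ _).trans ?_)
    refine (Finset.sum_le_card_nsmul _ _ c fun i _ => ?_).trans (by simp)
    rw [Algebra.leftMulMatrix_eq_repr_mul]
    by_cases h0 : b.repr (g * b i) (σ i) = 0
    · simp [h0]
    · exact Nat.le_of_lt_succ ((natDegree_lt_iff_degree_lt h0).2 (hgb i (σ i)))
  · rw [Algebra.norm_eq_matrix_det b]
    let A := Algebra.leftMulMatrix b g
    let w : B := b.equivFun.symm (A.adjugate.mulVec (b.equivFun 1))
    refine ⟨w, ?_⟩
    apply b.equivFun.injective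
    have h1 : b.equivFun (g * w) = A.mulVec (b.equivFun w) :=
      (Algebra.leftMulMatrix_mulVec_repr b g w).symm
    rw [h1, LinearEquiv.apply_symm_apply, Matrix.mulVec_mulVec, Matrix.mul_adjugate,
      Matrix.smul_mulVec, Matrix.one_mulVec, Algebra.algebraMap_eq_smul_one, map_smul]

section frobenius

variable [Fintype K]

/-- Powers of `x` of exponent less than `q` are independent over the field of `q`-th powers. -/
theorem eq_zero_of_eval₂_frobenius {B E : Type} [CommRing B] [Algebra K B] [Algebra K[X] B]
    [IsScalarTower K K[X] B] [Field E] [Algebra K E] [Algebra K[X] E] [IsScalarTower K K[X] E]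
    [Algebra B E] [IsScalarTower K[X] B E] [IsDomain B] [IsFractionRing B E]
    {h : K[X][X]} {y : B} (hy : aeval y h = 0) (hy' : aeval y (derivative h) ≠ 0)
    {ι : Type} [Fintype ι] (b : Module.Basis ι K[X] B) {e : ι → ℕ} (hb : ∀ i, b i = y ^ e i)
    (lift : ∀ (S : Type) [CommRing S] (α : K[X] →+* S) (y₁ : S), eval₂ α y₁ h = 0 →
        ∃ τ : B →+* S, τ.comp (algebraMap K[X] B) = α ∧ τ y = y₁)
    (ρ : E[X]) (hρ : ρ.natDegree < Fintype.card K)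
    (h0 : eval₂ (FiniteField.frobeniusAlgHom K E : E →+* E) (algebraMap K[X] E X) ρ = 0) :
    ρ = 0 := by
  set q := Fintype.card K with hq
  have hq0 : 0 < q := Fintype.card_pos
  obtain ⟨a, ha, haρ⟩ := IsLocalization.integerNormalization_spec (nonZeroDivisors B) ρ
  set R := IsLocalization.integerNormalization (nonZeroDivisors B) ρ with hR
  have ha0 : algebraMap B E a ≠ 0 := by
    simpa using nonZeroDivisors.ne_zero ha
  obtain ⟨Λ, _, _, u, b₁, _, _, _, _, y', hb₁, hu, hyΛ, hyn⟩ := exists_newton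
    (y₀ := algebraMap B E y) (h := h) (by rw [aeval_algebraMap_apply, hy, map_zero])
    (by rw [aeval_algebraMap_apply]; simpa using hy') hq0
  obtain ⟨σ, hσ, hσy⟩ := lift Λ (shiftHom u) y' hyΛ
  let φE : E →+* E := FiniteField.frobeniusAlgHom K E
  let φΛ : Λ →+* Λ := FiniteField.frobeniusAlgHom K Λ
  let ι : B →+* Λ := (algebraMap E Λ).comp (algebraMap B E)
  have hιX : ∀ r, ι (algebraMap K[X] B r) = algebraMap K[X] Λ r := fun r => by
    change algebraMap E Λ (algebraMap B E (algebraMap K[X] B r)) = _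
    rw [← IsScalarTower.algebraMap_apply K[X] B E, ← IsScalarTower.algebraMap_apply K[X] E Λ]
  have hagree : φΛ.comp σ = φΛ.comp ι := by
    have h1 : (φΛ.comp σ).comp (algebraMap K[X] B) = (φΛ.comp ι).comp (algebraMap K[X] B) := by
      rw [RingHom.comp_assoc, hσ]
      refine Polynomial.ringHom_ext (fun a => ?_) ?_
      · simp only [RingHom.comp_apply, hιX, shiftHom, coe_eval₂RingHom, eval₂_C]
        rw [IsScalarTower.algebraMap_apply K K[X] Λ]; rfl
      · simp only [RingHom.comp_apply, hιX, shiftHom, coe_eval₂RingHom, eval₂_X, map_add]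
        have : φΛ u = 0 := hu
        rw [this, add_zero]
    have h2 : φΛ.comp σ y = φΛ.comp ι y := by
      have : φΛ (ι y - y') = 0 := hyn
      rw [map_sub, sub_eq_zero] at this
      rw [RingHom.comp_apply, RingHom.comp_apply, hσy, this]
    ext z
    rw [← b.sum_repr z, map_sum, map_sum]
    refine Finset.sum_congr rfl fun i _ => ?_
    rw [Algebra.smul_def, map_mul, map_mul, hb, map_pow, map_pow, h2]
    congr 1
    exact RingHom.congr_fun h1 _
  have hR0 : eval₂ (φE.comp (algebraMap B E)) (algebraMap K[X] E X) R = 0 := by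
    rw [← eval₂_map, haρ, ← algebraMap_smul E a ρ, eval₂_smul]
    exact mul_eq_zero_of_right _ h0
  have hRB : eval₂ (FiniteField.frobeniusAlgHom K B : B →+* B) (algebraMap K[X] B X) R = 0 := by
    apply IsFractionRing.injective B E
    rw [map_zero, hom_eval₂, ← IsScalarTower.algebraMap_apply, ← hR0]
    congr 1
    ext z
    exact map_pow (algebraMap B E) z q
  let P : E[X] := (R.map (algebraMap B E)).map φE
  have hP0 : aeval (algebraMap K[X] Λ X + u) P = 0 := by
    have h1 := congrArg σ hRB
    rw [map_zero, hom_eval₂] at h1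
    rw [aeval_def, eval₂_map, eval₂_map, ← h1]
    have h2 : σ (algebraMap K[X] B X) = algebraMap K[X] Λ X + u := by
      rw [← RingHom.comp_apply, hσ]; simp [shiftHom]
    rw [h2]
    congr 1
    have h3 : σ.comp (FiniteField.frobeniusAlgHom K B : B →+* B) = φΛ.comp σ := by
      ext z
      exact map_pow σ z q
    rw [h3, hagree]
    ext z
    exact map_pow (algebraMap E Λ) _ q
  have hPdeg : P.natDegree < q := by
    refine lt_of_le_of_lt (natDegree_map_le.trans ?_) hρ
    rw [haρ]
    exact natDegree_smul_le _ _
  have ht : aeval u (taylor (algebraMap K[X] E X) P) = 0 := by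
    rw [← hP0, taylor_apply, aeval_comp]
    congr 1
    simp [← IsScalarTower.algebraMap_apply, add_comm]
  have hPzero : P = 0 := by
    apply taylor_injective (algebraMap K[X] E X)
    rw [map_zero]
    rw [aeval_eq_sum_range' (by rwa [natDegree_taylor]), ← Fin.sum_univ_eq_sum_range
      (fun i => (taylor (algebraMap K[X] E X) P).coeff i • u ^ i)] at ht
    simp only [← hb₁] at ht
    have h4 := Fintype.linearIndependent_iff.1 b₁.linearIndependent _ ht
    ext i
    rw [coeff_zero]
    by_cases hi : i < q
    · exact h4 ⟨i, hi⟩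
    · exact coeff_eq_zero_of_natDegree_lt (by rw [natDegree_taylor]; omega)
  have h5 : R.map (algebraMap B E) = 0 :=
    map_injective φE φE.injective (by rw [Polynomial.map_zero]; exact hPzero)
  rw [haρ, ← algebraMap_smul E a ρ] at h5
  exact (smul_eq_zero.1 h5).resolve_left ha0

end frobenius

theorem sum_C_mul_X_pow_eq_zero {E : Type} [Field E] {l : ℕ} {a : Fin l → E}
    (h : ∑ i, C (a i) * X ^ (i : ℕ) = 0) (i : Fin l) : a i = 0 := by
  have := congrArg (fun p => coeff p i) h
  simpa [finsetSum_coeff, coeff_X_pow, Fin.val_inj] using this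

variable [Fintype K] {B E : Type} [CommRing B] [Algebra K B] [Algebra K[X] B]
    [IsScalarTower K K[X] B] [Field E] [Algebra K E] [Algebra K[X] E] [IsScalarTower K K[X] E]
    [Algebra B E] [IsScalarTower K[X] B E] [IsDomain B] [IsFractionRing B E]

theorem evalForm_ne_zero {h : K[X][X]} (hh : h.Monic) (hirr : Irreducible h) {d c l m : ℕ}
    (hd : h.natDegree = d) (hc : ∀ i, (h.coeff i).natDegree ≤ c)
    (hconst : ∀ e : E, IsIntegral K e → e ∈ (algebraMap K E).range)
    {y : B} (hy : aeval y h = 0) (hy' : aeval y (derivative h) ≠ 0)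
    (b : Module.Basis (Fin d) K[X] B) (hb : ∀ i, b i = y ^ (i : ℕ))
    (lift : ∀ (S : Type) [CommRing S] (α : K[X] →+* S) (y₁ : S), eval₂ α y₁ h = 0 →
        ∃ τ : B →+* S, τ.comp (algebraMap K[X] B) = α ∧ τ y = y₁)
    (hq : d * (c * d + l) < Fintype.card K)
    {G : Fin l × Fin d × Fin m × Fin d → K} (hG : G ≠ 0) :
    evalForm (algebraMap K[X] B X) y (algebraMap K[X] B X ^ Fintype.card K)
      (y ^ Fintype.card K) G ≠ 0 := by
  intro hF
  set q := Fintype.card K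
  set x := algebraMap K[X] B X with hx
  let hE : E[X][X] := h.map (mapRingHom (algebraMap K E))
  have hEm : hE.Monic := hh.map _
  have hEd : hE.natDegree = d := by rw [← hd]; exact hh.natDegree_map _
  have hEirr : Irreducible hE := irreducible_map_mapRingHom hconst hh hirr
  obtain ⟨BE, _, _, Y, bE, hbE, hY, hdom, liftE⟩ := exists_adjoin hEm hEd
  have := hdom hEirr.prime
  let φ : E →+* E := FiniteField.frobeniusAlgHom K E
  have hα : (eval₂RingHom φ (algebraMap B E x)).comp (mapRingHom (algebraMap K E)) =
      (algebraMap B E).comp (algebraMap K[X] B) := by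
    refine Polynomial.ringHom_ext (fun a => ?_) ?_
    · simp only [RingHom.comp_apply, coe_mapRingHom, map_C, coe_eval₂RingHom, eval₂_C]
      rw [← IsScalarTower.algebraMap_apply K[X] B E]
      exact ((FiniteField.frobeniusAlgHom K E).commutes a).trans
        (IsScalarTower.algebraMap_apply K K[X] E a)
    · simp [hx]
  obtain ⟨Θ, hΘ, hΘY⟩ := liftE E (eval₂RingHom φ (algebraMap B E x)) (algebraMap B E y) (by
    rw [eval₂_map, hα, ← hom_eval₂, ← aeval_def, hy, map_zero])
  let β : Fin l → Fin d → E := fun i j =>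
    algebraMap B E (∑ k : Fin m, ∑ r : Fin d, G (i, j, k, r) • (x ^ (k : ℕ) * y ^ (r : ℕ)))
  let Gh : BE := ∑ i : Fin l, ∑ j : Fin d,
    algebraMap E[X] BE (C (β i j) * X ^ (i : ℕ)) * Y ^ (j : ℕ)
  have hGh : Gh ≠ 0 := by
    intro h0
    apply hG
    have h1 : ∑ j : Fin d, (∑ i : Fin l, C (β i j) * X ^ (i : ℕ)) • bE j = 0 := by
      rw [← h0]
      refine (Finset.sum_congr rfl fun j _ => ?_).trans Finset.sum_comm
      rw [Algebra.smul_def, hbE, map_sum, Finset.sum_mul]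
    have h2 : ∀ i j, β i j = 0 := fun i j =>
      sum_C_mul_X_pow_eq_zero (Fintype.linearIndependent_iff.1 bE.linearIndependent _ h1 j) i
    have h3 : ∀ i j, ∑ r : Fin d, (∑ k : Fin m, C (G (i, j, k, r)) * X ^ (k : ℕ)) • b r = 0 := by
      intro i j
      have h4 := (map_eq_zero_iff _ (IsFractionRing.injective B E)).1 (h2 i j)
      rw [← h4, Finset.sum_comm]
      refine Finset.sum_congr rfl fun r _ => ?_
      rw [Algebra.smul_def, hb, map_sum, Finset.sum_mul]
      refine Finset.sum_congr rfl fun k _ => ?_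
      rw [Algebra.smul_def, map_mul, map_pow, IsScalarTower.algebraMap_apply K K[X] B, mul_assoc]
      rfl
    ext ⟨i, j, k, r⟩
    exact sum_C_mul_X_pow_eq_zero
      (Fintype.linearIndependent_iff.1 b.linearIndependent _ (h3 i j) r) k
  have hΘG : Θ Gh = 0 := by
    rw [← map_zero (algebraMap B E), ← hF]
    simp only [Gh, evalForm, map_sum, Fintype.sum_prod_type, map_mul, map_pow, hΘY]
    refine Finset.sum_congr rfl fun i _ => Finset.sum_congr rfl fun j _ => ?_
    have e1 : Θ (algebraMap E[X] BE (C (β i j))) = φ (β i j) := by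
      rw [← RingHom.comp_apply, hΘ]; simp
    have e2 : Θ (algebraMap E[X] BE X) = algebraMap B E x := by
      rw [← RingHom.comp_apply, hΘ]; simp
    have e3 : φ (β i j) = algebraMap B E (∑ k : Fin m, ∑ r : Fin d,
        G (i, j, k, r) • ((x ^ q) ^ (k : ℕ) * (y ^ q) ^ (r : ℕ))) := by
      have : φ (β i j) = algebraMap B E (FiniteField.frobeniusAlgHom K B
          (∑ k : Fin m, ∑ r : Fin d, G (i, j, k, r) • (x ^ (k : ℕ) * y ^ (r : ℕ)))) :=
        (map_pow (algebraMap B E) _ q).symm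
      rw [this]
      simp only [map_sum, map_smul, map_mul, map_pow]
      rfl
    rw [e1, e2, e3, ← map_pow (algebraMap B E), ← map_pow (algebraMap B E), ← map_mul, ← map_mul]
    simp only [← map_sum, Finset.sum_mul]
    congr 1
    refine Finset.sum_congr rfl fun k _ => Finset.sum_congr rfl fun r _ => ?_
    rw [smul_mul_assoc, smul_mul_assoc]
    congr 1
    ring
  obtain ⟨ρ, hρ0, hρd, w, hw⟩ := exists_mul_eq_algebraMap (c := c * d + l) bE hGh (fun k => by
    simp only [Gh, Finset.sum_mul]
    refine sum_mem fun i _ => sum_mem fun j _ => ?_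
    rw [mul_assoc, ← Algebra.smul_def]
    have h1 := smul_mem_degSpace (pow_mul_mem_degSpace (root_mul_mem_degSpace hbE hEm hEd
      (fun i => (by rw [coeff_map]; exact natDegree_map_le.trans (hc i))) hY) (j : ℕ)
      (basis_mem_degSpace k)) (natDegree_C_mul_X_pow_le (β i j) (i : ℕ))
    refine degSpace_mono ?_ h1
    have := Nat.mul_le_mul_left c j.2.le
    have := i.2
    omega)
  refine hρ0 (eq_zero_of_eval₂_frobenius hy hy' b hb lift ρ (hρd.trans_lt hq) ?_)
  have h1 : Θ (algebraMap E[X] BE ρ) = 0 := by rw [hw, map_mul, hΘG, zero_mul]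
  rw [← RingHom.comp_apply, hΘ] at h1
  rw [IsScalarTower.algebraMap_apply K[X] B E]
  exact h1

end independence

section core

variable {K : Type} [Field K]

theorem map_evalForm {B B' : Type} [CommRing B] [Algebra K B] [CommRing B'] [Algebra K B']
    (τ : B →ₐ[K] B') {l d m : ℕ}
    (x y x' y' : B) (G : Fin l × Fin d × Fin m × Fin d → K) :
    τ (evalForm x y x' y' G) = evalForm (τ x) (τ y) (τ x') (τ y') G := by
  simp [evalForm]

variable {B : Type} [CommRing B] [Algebra K B] [Algebra K[X] B] [IsScalarTower K K[X] B]

theorem evalForm_mem_degSpace {h : K[X][X]} (hh : h.Monic) {d c l m : ℕ}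
    (hd : h.natDegree = d) (hc : ∀ i, (h.coeff i).natDegree ≤ c) {y : B} (hy : aeval y h = 0)
    (b : Module.Basis (Fin d) K[X] B) (hb : ∀ i, b i = y ^ (i : ℕ)) (q : ℕ)
    (G : Fin l × Fin d × Fin m × Fin d → K) :
    evalForm (algebraMap K[X] B X) y (algebraMap K[X] B X ^ q) (y ^ q) G ∈
      degSpace b (l + q * (m - 1) + c * (d * (q + 1))) := by
  refine sum_mem ?_
  rintro ⟨i, j, k, r⟩ -
  have hd0 : 0 < d := j.pos
  have e : G (i, j, k, r) • (algebraMap K[X] B X ^ (i : ℕ) * y ^ (j : ℕ) *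
      ((algebraMap K[X] B X ^ q) ^ (k : ℕ) * (y ^ q) ^ (r : ℕ))) =
      (C (G (i, j, k, r)) * X ^ (i + q * k : ℕ)) • (y ^ (j + q * r : ℕ) * b ⟨0, hd0⟩) := by
    rw [hb, Algebra.smul_def (C _ * _), map_mul, map_pow, Algebra.smul_def,
      IsScalarTower.algebraMap_apply K K[X] B]
    simp only [pow_zero, algebraMap_eq]
    ring
  rw [e]
  have h1 := smul_mem_degSpace (pow_mul_mem_degSpace (root_mul_mem_degSpace hb hh hd hc hy)
    (j + q * r : ℕ) (basis_mem_degSpace ⟨0, hd0⟩))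
    (natDegree_C_mul_X_pow_le (G (i, j, k, r)) (i + q * k : ℕ))
  refine degSpace_mono ?_ h1
  have h2 : (j : ℕ) + q * r ≤ d * (q + 1) := by
    have := Nat.mul_le_mul_left q r.2.le
    have := j.2
    rw [mul_add, mul_comm d q]; omega
  have h3 := Nat.mul_le_mul_left c h2
  have h4 := Nat.mul_le_mul_left q (Nat.le_sub_one_of_lt k.2)
  have := i.2
  omega

variable [Fintype K]

theorem isCoprime_X_pow_card_sub_X {p : K[X]} (hp : ∀ a, p.eval a ≠ 0) :
    IsCoprime p (X ^ Fintype.card K - X) := by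
  have h1 : (X ^ Fintype.card K - X : K[X]) = ∏ a : K, (X - C a) := by
    have hq := Fintype.one_lt_card (α := K)
    have hr := FiniteField.roots_X_pow_card_sub_X K
    have hd := FiniteField.X_pow_card_sub_X_natDegree_eq K hq
    have hm : (X ^ Fintype.card K - X : K[X]).Monic :=
      monic_X_pow_sub (by rw [degree_X]; exact_mod_cast hq)
    rw [← prod_multiset_X_sub_C_of_monic_of_roots_card_eq hm (by rw [hr, hd]; rfl), hr]
    rfl
  rw [h1]
  refine IsCoprime.prod_right fun a _ => ?_
  rw [isCoprime_comm, (irreducible_X_sub_C a).coprime_iff_not_dvd, dvd_iff_isRoot]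
  exact hp a

theorem isCoprime_sub_pow_card {h : K[X][X]} {y : B} (hy : aeval y h = 0) {x₀ : K}
    (hx₀ : ∀ a, (h.map (evalRingHom x₀)).eval a ≠ 0) :
    IsCoprime (y - y ^ Fintype.card K) (algebraMap K[X] B (X - C x₀)) := by
  have h1 := (isCoprime_X_pow_card_sub_X hx₀).map (aeval y : K[X] →ₐ[K] B).toRingHom
  have h2 : algebraMap K[X] B (X - C x₀) ∣ aeval y (h.map (evalRingHom x₀)) := by
    have e1 : aeval y (h.map (evalRingHom x₀)) = ∑ i ∈ Finset.range (h.natDegree + 1),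
        algebraMap K[X] B (C ((h.coeff i).eval x₀) - h.coeff i) * y ^ i := by
      rw [aeval_def, eval₂_map, eval₂_eq_sum_range, ← sub_zero (Finset.sum _ _), ← hy, aeval_def,
        eval₂_eq_sum_range, ← Finset.sum_sub_distrib]
      refine Finset.sum_congr rfl fun i _ => ?_
      rw [map_sub, sub_mul, RingHom.comp_apply, IsScalarTower.algebraMap_apply K K[X] B]
      rfl
    rw [e1]
    refine Finset.dvd_sum fun i _ => Dvd.dvd.mul_right (_root_.map_dvd _ ?_) _
    rw [← neg_sub (h.coeff i)]
    exact dvd_neg.2 X_sub_C_dvd_sub_C_eval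
  have h3 := (h1.of_isCoprime_of_dvd_left h2).symm.neg_left
  convert h3 using 1
  simp

theorem card_good_mul_lt {h : K[X][X]} {d D M : ℕ} {y : B} (hy : aeval y h = 0)
    (b : Module.Basis (Fin d) K[X] B) {v : B} (hv : v ≠ 0) (hvD : v ∈ degSpace b D)
    (hdvd : algebraMap K[X] B (X ^ Fintype.card K - X) ^ M ∣ (y - y ^ Fintype.card K) ^ M * v)
    (s : Finset K) (hs : ∀ x₀ ∈ s, ∀ a, (h.map (evalRingHom x₀)).eval a ≠ 0) :
    M * s.card < D := by
  obtain ⟨i, hi⟩ : ∃ i, b.repr v i ≠ 0 := by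
    by_contra! h0
    exact hv (b.repr.map_eq_zero_iff.1 (Finsupp.ext h0))
  have h1 : ∀ x₀ ∈ s, (X - C x₀) ^ M ∣ b.repr v i := by
    intro x₀ hx₀
    have h2 := isCoprime_sub_pow_card hy (hs x₀ hx₀)
    have h3 : algebraMap K[X] B (X - C x₀) ^ M ∣ v := by
      refine (h2.symm.pow (m := M) (n := M)).dvd_of_dvd_mul_left (dvd_trans ?_ hdvd)
      refine pow_dvd_pow_of_dvd (_root_.map_dvd _ ?_) M
      rw [dvd_iff_isRoot]
      simp [FiniteField.pow_card]
    obtain ⟨w, rfl⟩ := h3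
    rw [← map_pow, ← Algebra.smul_def, map_smul]
    exact ⟨_, rfl⟩
  have h2 : ∏ x₀ ∈ s, (X - C x₀) ^ M ∣ b.repr v i := by
    refine Finset.prod_dvd_of_coprime (fun a _ a' _ haa => ?_) h1
    exact (pairwise_coprime_X_sub_C Function.injective_id haa).pow
  have h3 := natDegree_le_of_dvd h2 hi
  rw [natDegree_prod_of_monic _ _ fun a _ => (monic_X_sub_C a).pow M] at h3
  simp only [natDegree_pow, natDegree_X_sub_C, mul_one, Finset.sum_const, smul_eq_mul] at h3
  have h4 := (natDegree_lt_iff_degree_lt hi).2 (hvD i)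
  rw [mul_comm] at h3
  omega

/-- A bound for the size of a finite field over which a non-constant cover of degree `d` and
height `c` may have rational points over at most `c₀` values of the parameter. -/
def coreBound (d c c₀ : ℕ) : ℕ :=
  let s := c * d + 2
  let M := d * s
  let m := (d - 1) * s + 1
  let l := m * (m + c * M) + 1
  d * (c * d + l) + l + c * d + M * c₀ + 1

theorem card_lt_coreBound {E₀ : Type} [Field E₀] [Algebra K E₀] [Algebra K[X] E₀]
    [IsScalarTower K K[X] E₀] (hconst : ∀ e : E₀, IsIntegral K e → e ∈ (algebraMap K E₀).range)
    {h : K[X][X]} (hh : h.Monic) (hirr : Irreducible h) {d c c₀ : ℕ} (hd : h.natDegree = d)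
    (hc : ∀ i, (h.coeff i).natDegree ≤ c) {y₀ : E₀} (hy₀ : aeval y₀ h = 0)
    (hmin : ∀ p : K[X][X], aeval y₀ p = 0 → h ∣ p) (hy₀' : aeval y₀ (derivative h) ≠ 0)
    (bad : Finset K) (hbad : bad.card ≤ c₀)
    (hgood : ∀ x₀ ∉ bad, ∀ a, (h.map (evalRingHom x₀)).eval a ≠ 0) :
    Fintype.card K < coreBound d c c₀ := by
  classical
  by_contra! hq
  have hd0 : 0 < d := hd ▸ Nat.pos_of_ne_zero fun h0 =>
    hirr.1 (eq_one_of_monic_natDegree_zero hh h0 ▸ isUnit_one)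
  obtain ⟨B, _, _, y, b, hb, hy, hdom, lift⟩ := exists_adjoin hh hd
  have := hdom hirr.prime
  let _ : Algebra K B := ((algebraMap K[X] B).comp C).toAlgebra
  have : IsScalarTower K K[X] B := IsScalarTower.of_algebraMap_eq' rfl
  obtain ⟨g, hg, hgy⟩ := lift E₀ (algebraMap K[X] E₀) y₀ hy₀
  let g' : B →ₐ[K[X]] E₀ := ⟨g, fun r => RingHom.congr_fun hg r⟩
  have hginj : Function.Injective g' := by
    rw [injective_iff_map_eq_zero]
    intro z hz
    let p : K[X][X] := ∑ i, C (b.repr z i) * X ^ (i : ℕ)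
    have hp : aeval y p = z := by
      conv_rhs => rw [← b.sum_repr z]
      simp only [p, map_sum, map_mul, aeval_C, map_pow, aeval_X, hb, Algebra.smul_def]
    obtain ⟨r, hr⟩ := hmin p (by
      have : g' y = y₀ := hgy
      rw [← this, aeval_algHom_apply, hp, hz])
    rw [← hp, hr, map_mul]
    exact mul_eq_zero_of_left hy _
  have hy' : aeval y (derivative h) ≠ 0 := fun h0 => hy₀' (by
    have : g' y = y₀ := hgy
    rw [← this, aeval_algHom_apply, h0, map_zero])
  let E := FractionRing B
  have hconstE : ∀ e : E, IsIntegral K e → e ∈ (algebraMap K E).range := by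
    intro e he
    let φ : E →ₐ[K] E₀ := IsFractionRing.liftAlgHom (g := g'.restrictScalars K) hginj
    obtain ⟨a, ha⟩ := hconst _ (he.map φ)
    exact ⟨a, φ.toRingHom.injective ((φ.commutes a).trans ha)⟩
  set q := Fintype.card K with hqdef
  set s := c * d + 2 with hs
  set M := d * s with hM
  set m := (d - 1) * s + 1 with hm
  set l := m * (m + c * M) + 1 with hl
  have hq' : d * (c * d + l) + l + c * d + M * c₀ + 1 ≤ q := hq
  have hM0 : 0 < M := by positivity
  have hineq : d * (d - 1) * M * (l + m + c * M) < l * (d * (m * d)) := by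
    have h1 : (d - 1) * M = d * (m - 1) := by
      rw [hM, hm, Nat.add_sub_cancel]
      ring
    obtain ⟨m', hm'⟩ : ∃ m', m = m' + 1 := ⟨_, hm⟩
    rw [hm', Nat.add_sub_cancel] at h1
    have h2 : m' * (m + c * M) < l := by
      rw [hl, hm']
      nlinarith
    calc d * (d - 1) * M * (l + m + c * M) = d * d * (m' * l + m' * (m + c * M)) := by
          rw [mul_assoc d, h1]
          ring
      _ < d * d * (m' * l + l) :=
          Nat.mul_lt_mul_of_pos_left (Nat.add_lt_add_left h2 _) (Nat.mul_pos hd0 hd0)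
      _ = l * (d * (m * d)) := by
          rw [hm']
          ring
  have hli : LinearIndependent K[X] fun i : Fin d => algebraMap B E y ^ (i : ℕ) := by
    have e : (fun i : Fin d => algebraMap B E y ^ (i : ℕ)) =
        (IsScalarTower.toAlgHom K[X] B E).toLinearMap ∘ b := by
      ext i
      simp [hb]
    rw [e]
    exact b.linearIndependent.map_injOn _ (IsFractionRing.injective B E).injOn
  obtain ⟨G, hG, hGS⟩ := exists_form (E := E) hh hd hd0 hc (y₀ := algebraMap B E y)
    (by rw [aeval_algebraMap_apply, aeval_def, hy, map_zero])
    (by rw [aeval_algebraMap_apply]; simpa using hy')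
    hli (l := l) (m := m) hM0 hineq
  have hF := evalForm_ne_zero (E := E) hh hirr hd hc hconstE hy hy' b hb lift
    (by omega) hG
  have hFD := evalForm_mem_degSpace hh hd hc hy b hb q G
  have hdvd : algebraMap K[X] B (X ^ q - X) ^ M ∣ (y - y ^ q) ^ M *
      evalForm (algebraMap K[X] B X) y (algebraMap K[X] B X ^ q) (y ^ q) G := by
    let I : Ideal B := Ideal.span {algebraMap K[X] B (X ^ q - X) ^ M}
    let τ : B →ₐ[K[X]] B ⧸ I := Ideal.Quotient.mkₐ K[X] I
    have h1 : τ (algebraMap K[X] B (X ^ q - X)) ^ M = 0 := by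
      rw [← map_pow]
      exact Ideal.Quotient.eq_zero_iff_mem.2 (Ideal.mem_span_singleton_self _)
    have h2 : aeval (τ y) h = 0 := by
      rw [aeval_algHom_apply, aeval_def, hy, map_zero]
    have h3 : eval₂ (shiftHom (algebraMap K[X] B (X ^ q - X))) (y ^ q) h = 0 := by
      have h6 : (shiftHom (algebraMap K[X] B (X ^ q - X)) : K[X] →+* B) =
          (FiniteField.frobeniusAlgHom K B : B →+* B).comp (algebraMap K[X] B) := by
        refine Polynomial.ringHom_ext (fun a => ?_) ?_
        · simp only [shiftHom, coe_eval₂RingHom, eval₂_C, RingHom.comp_apply]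
          exact ((FiniteField.frobeniusAlgHom K B).commutes a).symm
        · simp [shiftHom, hqdef]
      have h7 := hom_eval₂ h (algebraMap K[X] B) (FiniteField.frobeniusAlgHom K B : B →+* B) y
      rw [hy, map_zero] at h7
      rw [h6, h7]
      rfl
    have h4 : eval₂ (shiftHom (τ (algebraMap K[X] B (X ^ q - X)))) (τ (y ^ q)) h = 0 := by
      rw [← map_eval₂_shiftHom, h3, map_zero]
    have hτ := map_evalForm (τ.restrictScalars K) (algebraMap K[X] B X) y
      (algebraMap K[X] B X ^ q) (y ^ q) G
    simp only [AlgHom.restrictScalars_apply] at hτ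
    have h5 := hGS (B ⧸ I) (τ y) (τ (algebraMap K[X] B (X ^ q - X))) (τ (y ^ q)) h1 h2 h4
    rw [← Ideal.mem_span_singleton]
    refine Ideal.Quotient.eq_zero_iff_mem.1 ?_
    change τ _ = 0
    rw [← h5, map_mul, map_pow, map_sub, hτ]
    have h8 : algebraMap K[X] (B ⧸ I) X + τ (algebraMap K[X] B (X ^ q - X)) =
        τ (algebraMap K[X] B X ^ q) := by
      rw [← τ.commutes X, ← map_add, map_sub, map_pow, add_sub_cancel]
    rw [h8]
    rw [τ.commutes]
  have hcard := card_good_mul_lt hy b hF hFD hdvd badᶜ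
    (fun x₀ hx₀ => hgood x₀ (Finset.mem_compl.1 hx₀))
  have h1 : M * badᶜ.card + M * bad.card = M * q := by
    rw [← mul_add, Finset.card_compl, Nat.sub_add_cancel (Finset.card_le_univ bad)]
  have h2 : M * q = q * (m - 1) + c * (d * q) + 2 * q := by
    obtain ⟨d', rfl⟩ : ∃ d', d = d' + 1 := ⟨d - 1, by omega⟩
    rw [hm, Nat.add_sub_cancel, hM, Nat.add_sub_cancel, hs]
    ring
  have h3 := Nat.mul_le_mul_left M hbad
  have h4 : c * (d * (q + 1)) = c * (d * q) + c * d := by ring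
  omega

end core

section bivariate

variable {K : Type} [Field K]

theorem coeff_coeff_swap (p : K[X][X]) (i j : ℕ) :
    ((Bivariate.swap p).coeff i).coeff j = (p.coeff j).coeff i := by
  induction p using Polynomial.induction_on' with
  | add p r hp hr => simp only [map_add, coeff_add, hp, hr]
  | monomial a r =>
    induction r using Polynomial.induction_on' with
    | add p r hp hr => simp only [map_add, coeff_add, hp, hr]
    | monomial b r =>
      rw [Bivariate.swap_monomial_monomial]
      simp only [coeff_monomial]
      split_ifs <;> simp [coeff_monomial, *]

theorem natDegree_swap_le_iff {p : K[X][X]} {c : ℕ} :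
    (Bivariate.swap p).natDegree ≤ c ↔ ∀ i, (p.coeff i).natDegree ≤ c := by
  simp only [natDegree_le_iff_coeff_eq_zero]
  constructor
  · intro h i N hN
    rw [← coeff_coeff_swap, h N hN, coeff_zero]
  · intro h N hN
    ext i
    rw [coeff_coeff_swap, h i N hN, coeff_zero]

theorem natDegree_coeff_le_of_dvd {p r : K[X][X]} (hr : r ≠ 0) (h : p ∣ r) {c : ℕ}
    (hc : ∀ i, (r.coeff i).natDegree ≤ c) (i : ℕ) : (p.coeff i).natDegree ≤ c :=
  natDegree_swap_le_iff.1 ((natDegree_le_of_dvd (_root_.map_dvd Bivariate.swap h)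
    ((map_ne_zero_iff _ Bivariate.swap.injective).2 hr)).trans (natDegree_swap_le_iff.2 hc)) i

/-- The polynomial `g(X) f(Y) - f(X) g(Y)` in `K[X][Y]`. -/
def crossPoly (f g : K[X]) : K[X][X] := C g * f.map C - C f * g.map C

theorem coeff_crossPoly (f g : K[X]) (i : ℕ) :
    (crossPoly f g).coeff i = C (f.coeff i) * g - C (g.coeff i) * f := by
  simp only [crossPoly, coeff_sub, coeff_C_mul, coeff_map]
  ring

theorem natDegree_coeff_crossPoly_le {f g : K[X]} {n : ℕ} (hf : f.natDegree ≤ n)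
    (hg : g.natDegree ≤ n) (i : ℕ) : ((crossPoly f g).coeff i).natDegree ≤ n := by
  rw [coeff_crossPoly]
  exact (natDegree_sub_le _ _).trans
    (max_le ((natDegree_C_mul_le _ _).trans hg) ((natDegree_C_mul_le _ _).trans hf))

theorem eval₂_crossPoly {S : Type} [CommRing S] (α : K[X] →+* S) (y : S) (f g : K[X]) :
    eval₂ α y (crossPoly f g) =
      α g * eval₂ (α.comp C) y f - α f * eval₂ (α.comp C) y g := by
  simp [crossPoly, eval₂_map]

theorem natDegree_crossPoly {f g : K[X]} (hfg : IsCoprime f g)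
    (hn : 0 < max f.natDegree g.natDegree) :
    (crossPoly f g).natDegree = max f.natDegree g.natDegree := by
  refine natDegree_eq_of_le_of_coeff_ne_zero ?_ ?_
  · rw [natDegree_le_iff_coeff_eq_zero]
    intro N hN
    rw [coeff_crossPoly, coeff_eq_zero_of_natDegree_lt (lt_of_le_of_lt (le_max_left _ _) hN),
      coeff_eq_zero_of_natDegree_lt (lt_of_le_of_lt (le_max_right _ _) hN)]
    simp
  · rw [coeff_crossPoly, sub_ne_zero]
    intro h0
    rcases le_total f.natDegree g.natDegree with h | h
    · rw [max_eq_right h] at h0 hn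
      have hg : g ≠ 0 := by rintro rfl; simp at hn
      have h1 : g ∣ C (g.coeff g.natDegree) * f := h0 ▸ dvd_mul_left _ _
      have h2 := isUnit_C.2 (leadingCoeff_ne_zero.2 hg).isUnit
      rw [leadingCoeff] at h2
      have := natDegree_eq_zero_of_isUnit
        (hfg.isUnit_of_dvd' ((h2.dvd_mul_left).1 h1) dvd_rfl)
      omega
    · rw [max_eq_left h] at h0 hn
      have hf : f ≠ 0 := by rintro rfl; simp at hn
      have h1 : f ∣ C (f.coeff f.natDegree) * g := h0 ▸ dvd_mul_left _ _
      have h2 := isUnit_C.2 (leadingCoeff_ne_zero.2 hf).isUnit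
      rw [leadingCoeff] at h2
      have := natDegree_eq_zero_of_isUnit
        (hfg.isUnit_of_dvd' dvd_rfl ((h2.dvd_mul_left).1 h1))
      omega

theorem natDegree_coeff_integralNormalization_le {p : K[X][X]} {n : ℕ} (hn : p.natDegree = n)
    (hc : ∀ i, (p.coeff i).natDegree ≤ n) (i : ℕ) :
    (p.integralNormalization.coeff i).natDegree ≤ n * n := by
  rw [integralNormalization_coeff]
  split_ifs with h
  · simp
  · rcases lt_or_ge n i with hi | hi
    · rw [coeff_eq_zero_of_natDegree_lt (hn ▸ hi)]
      simp
    · rcases Nat.eq_zero_or_pos n with h0 | h0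
      · have : i = 0 := by omega
        subst this h0
        have := natDegree_mul_le (p := p.coeff 0) (q := p.leadingCoeff ^ (p.natDegree - 1 - 0))
        have := hc 0
        simp_all
      · calc _ ≤ n + (p.natDegree - 1 - i) * n :=
              natDegree_mul_le.trans (Nat.add_le_add (hc i)
                (natDegree_pow_le.trans (Nat.mul_le_mul_left _ (hc _))))
          _ ≤ n + (n - 1) * n := Nat.add_le_add_left (Nat.mul_le_mul_right _ (by omega)) _
          _ = n * n := by
              obtain ⟨k, rfl⟩ : ∃ k, n = k + 1 := ⟨n - 1, by omega⟩
              simp only [Nat.add_sub_cancel]; ring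

theorem mul_eval₂_derivative_integralNormalization {p : K[X][X]} (hp : 1 ≤ p.natDegree)
    {S : Type} [CommRing S] (α : K[X] →+* S) (x : S) :
    α p.leadingCoeff * eval₂ α (α p.leadingCoeff * x) (derivative p.integralNormalization) =
      α p.leadingCoeff ^ (p.natDegree - 1) * eval₂ α x (derivative p) := by
  have h1 := integralNormalization_eval₂_leadingCoeff_mul hp ((C : S →+* S[X]).comp α) X
  have h2 (r : K[X][X]) (z : S[X]) : eval₂ ((C : S →+* S[X]).comp α) z r = (r.map α).comp z := by
    rw [comp, eval₂_map]
  rw [h2, h2, comp_X] at h1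
  have h3 := congrArg (fun r => eval x (derivative r)) h1
  simp only [RingHom.comp_apply, derivative_comp, ← C_pow, derivative_C_mul, derivative_X,
    eval_mul, eval_C, eval_comp, eval_X, derivative_map, eval_map, mul_one] at h3
  exact h3

end bivariate

/-- A bound, in terms of `n`, for the size of a finite field over which a rational function of
degree `n` having a second root in a field with the same constants may be injective. -/
def injectiveBound (n : ℕ) : ℕ :=
  ∑ d ∈ Finset.range (n + 1), coreBound d (n * n) (n + (n * n + n * (n + 1)))

theorem card_lt_injectiveBound {K : Type} [Field K] [Fintype K] {E₀ : Type} [Field E₀]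
    [Algebra K E₀] (hconst : ∀ e : E₀, IsIntegral K e → e ∈ (algebraMap K E₀).range)
    {f g : K[X]} (hfg : IsCoprime f g) {n : ℕ} (hn : max f.natDegree g.natDegree = n) (hn0 : 0 < n)
    {x₁ x₂ : E₀} (hx : x₁ ≠ x₂) (hx₁ : Transcendental K x₁)
    (h12 : aeval x₁ g * aeval x₂ f = aeval x₁ f * aeval x₂ g)
    (hsep : aeval x₁ g * aeval x₂ (derivative f) ≠ aeval x₁ f * aeval x₂ (derivative g))
    (hinj : ∀ a b : K, g.eval a * f.eval b = f.eval a * g.eval b → a = b) :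
    Fintype.card K < injectiveBound n := by
  classical
  let _ : Algebra K[X] E₀ := (aeval x₁ : K[X] →ₐ[K] E₀).toRingHom.toAlgebra
  have hα (r : K[X]) : algebraMap K[X] E₀ r = aeval x₁ r := rfl
  have hαC : (algebraMap K[X] E₀).comp C = algebraMap K E₀ := by
    ext a
    simp [hα]
  have : IsScalarTower K K[X] E₀ := IsScalarTower.of_algebraMap_eq' hαC.symm
  have hαinj : Function.Injective (algebraMap K[X] E₀) := transcendental_iff_injective.1 hx₁
  have : FaithfulSMul K[X] E₀ := (faithfulSMul_iff_algebraMap_injective _ _).2 hαinj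
  set Θ := crossPoly f g with hΘ
  have hΘn : Θ.natDegree = n := (natDegree_crossPoly hfg (hn ▸ hn0)).trans hn
  have hΘ0 : Θ ≠ 0 := by rintro h0; rw [h0] at hΘn; simp at hΘn; omega
  set W := Θ.leadingCoeff with hW
  have hW0 : W ≠ 0 := leadingCoeff_ne_zero.2 hΘ0
  have hΘc : ∀ i, (Θ.coeff i).natDegree ≤ n := natDegree_coeff_crossPoly_le
    ((le_max_left _ _).trans hn.le) ((le_max_right _ _).trans hn.le)
  set Ψ := Θ.integralNormalization with hΨ
  have hΨm : Ψ.Monic := monic_integralNormalization hΘ0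
  set y₀ := algebraMap K[X] E₀ W * x₂ with hy₀
  have hΘx : aeval x₂ Θ = 0 := by
    rw [aeval_def, eval₂_crossPoly, hαC]
    exact sub_eq_zero.2 h12
  have hΨy : aeval y₀ Ψ = 0 :=
    integralNormalization_aeval_eq_zero hΘx ((injective_iff_map_eq_zero _).1 hαinj)
  have hΨy' : aeval y₀ (derivative Ψ) ≠ 0 := by
    intro h0
    have h1 := mul_eval₂_derivative_integralNormalization (hΘn ▸ hn0) (algebraMap K[X] E₀) x₂
    have h2 : eval₂ (algebraMap K[X] E₀) x₂ (derivative Θ) ≠ 0 := by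
      have h3 : derivative Θ = C g * (derivative f).map C - C f * (derivative g).map C := by
        simp [hΘ, crossPoly, derivative_map]
      rw [h3]
      simp only [eval₂_sub, eval₂_mul, eval₂_C, eval₂_map, hαC]
      exact sub_ne_zero.2 hsep
    rw [← aeval_def, h0, mul_zero] at h1
    exact mul_ne_zero (pow_ne_zero _ ((map_ne_zero_iff _ hαinj).2 hW0)) h2 h1.symm
  have hinteg : IsIntegral K[X] y₀ := ⟨Ψ, hΨm, hΨy⟩
  set h := minpoly K[X] y₀ with hh
  have hmin (p : K[X][X]) (hp : aeval y₀ p = 0) : h ∣ p := minpoly.isIntegrallyClosed_dvd hinteg hp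
  have hirr : Irreducible h := minpoly.irreducible hinteg
  have hm : h.Monic := minpoly.monic hinteg
  have hhy : aeval y₀ h = 0 := minpoly.aeval _ _
  have hdvd := hmin Ψ hΨy
  have hc := natDegree_coeff_le_of_dvd hΨm.ne_zero hdvd
    (natDegree_coeff_integralNormalization_le hΘn hΘc)
  have hd : h.natDegree ≤ n :=
    (natDegree_le_of_dvd hdvd hΨm.ne_zero).trans (natDegree_integralNormalization.trans hΘn).le
  have hhy' : aeval y₀ (derivative h) ≠ 0 := by
    obtain ⟨r, hr⟩ := hdvd
    intro h0
    apply hΨy'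
    rw [hr, derivative_mul, map_add, map_mul, map_mul, h0, hhy, zero_mul, zero_mul, add_zero]
  set H := h.eval (W * X) with hH
  have hH0 : H ≠ 0 := by
    intro h0
    obtain ⟨r, hr⟩ := dvd_iff_isRoot.2 h0
    have h1 : r = 1 := by
      have h2 : IsUnit r := (hirr.isUnit_or_isUnit hr).resolve_left (not_isUnit_X_sub_C _)
      exact (Monic.of_mul_monic_left (monic_X_sub_C (W * X)) (hr ▸ hm)).eq_one_of_isUnit h2
    rw [h1, mul_one] at hr
    rw [hr] at hhy
    simp only [map_sub, aeval_X, aeval_C, sub_eq_zero, hy₀, map_mul] at hhy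
    have h3 := mul_left_cancel₀ ((map_ne_zero_iff _ hαinj).2 hW0) hhy
    rw [hα, aeval_X] at h3
    exact hx h3.symm
  have hHd : H.natDegree ≤ n * n + n * (n + 1) := by
    rw [hH, eval_eq_sum_range]
    refine natDegree_sum_le_of_forall_le _ _ fun i hi => ?_
    refine natDegree_mul_le.trans (Nat.add_le_add (hc i) (natDegree_pow_le.trans ?_))
    refine Nat.mul_le_mul ((Nat.lt_succ_iff.1 (Finset.mem_range.1 hi)).trans hd) ?_
    exact natDegree_mul_le.trans (Nat.add_le_add (hΘc _) natDegree_X_le)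
  refine (card_lt_coreBound hconst hm hirr rfl hc hhy hmin hhy'
    (W.roots.toFinset ∪ H.roots.toFinset)
    (c₀ := n + (n * n + n * (n + 1))) ?_ ?_).trans_le ?_
  · refine (Finset.card_union_le _ _).trans (Nat.add_le_add ?_ ?_)
    · exact (Multiset.toFinset_card_le _).trans ((card_roots' _).trans (hΘc _))
    · exact (Multiset.toFinset_card_le _).trans ((card_roots' _).trans hHd)
  · intro x₀ hx₀ a ha
    simp only [Finset.mem_union, Multiset.mem_toFinset, mem_roots hW0, mem_roots hH0, not_or,
      IsRoot.def] at hx₀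
    have h1 : eval₂ (evalRingHom x₀) a Ψ = 0 := by
      rw [← eval_map]
      exact eval_eq_zero_of_dvd_of_eval_eq_zero (Polynomial.map_dvd _ hdvd) ha
    have h2 := integralNormalization_eval₂_leadingCoeff_mul (hΘn ▸ hn0) (evalRingHom x₀)
      (a / W.eval x₀)
    rw [← hW, coe_evalRingHom, mul_div_cancel₀ _ hx₀.1, ← coe_evalRingHom, h1, eq_comm,
      mul_eq_zero,
      or_iff_right (pow_ne_zero (Θ.natDegree - 1) (M₀ := K) (a := evalRingHom x₀ W) hx₀.1),
      eval₂_crossPoly, sub_eq_zero] at h2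
    have h3 : (evalRingHom x₀).comp C = RingHom.id K := by ext; simp
    rw [h3] at h2
    have h4 : x₀ = a / W.eval x₀ := hinj x₀ _ h2
    apply hx₀.2
    rw [hH, ← coe_evalRingHom, ← eval₂_hom, ← eval_map, coe_evalRingHom, eval_mul, eval_X]
    rw [eq_div_iff hx₀.1] at h4
    rw [mul_comm, h4, ha]
  · exact Finset.single_le_sum (f := fun d => coreBound d (n * n) (n + (n * n + n * (n + 1))))
      (fun _ _ => Nat.zero_le _) (Finset.mem_range.2 (Nat.lt_succ_of_le hd))

section irreducibility

variable {k : Type} [Field k]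

/-- The polynomial `f(Y) - X g(Y)` in `k[X][Y]`. -/
def integralFiberPoly (f g : k[X]) : k[X][X] := f.map C - C X * g.map C

theorem map_integralFiberPoly (f g : k[X]) :
    (integralFiberPoly f g).map (algebraMap k[X] (RatFunc k)) = fiberPoly f g := by
  have h : (algebraMap k[X] (RatFunc k)).comp C = algebraMap k (RatFunc k) := rfl
  rw [integralFiberPoly, fiberPoly, Polynomial.map_sub, Polynomial.map_mul, Polynomial.map_map,
    Polynomial.map_map, h, map_C, RatFunc.algebraMap_X]

theorem natDegree_integralFiberPoly {f g : k[X]} (hn : 0 < max f.natDegree g.natDegree) :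
    (integralFiberPoly f g).natDegree = max f.natDegree g.natDegree := by
  have hc (i : ℕ) : (integralFiberPoly f g).coeff i = C (f.coeff i) - X * C (g.coeff i) := by
    simp [integralFiberPoly]
  refine natDegree_eq_of_le_of_coeff_ne_zero ?_ ?_
  · rw [natDegree_le_iff_coeff_eq_zero]
    intro N hN
    rw [hc, coeff_eq_zero_of_natDegree_lt (lt_of_le_of_lt (le_max_left _ _) hN),
      coeff_eq_zero_of_natDegree_lt (lt_of_le_of_lt (le_max_right _ _) hN)]
    simp
  · rw [hc]
    intro h0
    have h1 := congrArg (fun p => coeff p 0) h0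
    have h2 := congrArg (fun p => coeff p 1) h0
    simp [coeff_C] at h1 h2
    rcases le_total f.natDegree g.natDegree with h | h
    · rw [max_eq_right h] at h2 hn
      have := leadingCoeff_eq_zero.1 h2
      simp [this] at hn
    · rw [max_eq_left h] at h1 hn
      have := leadingCoeff_eq_zero.1 h1
      simp [this] at hn

theorem natDegree_fiberPoly {f g : k[X]} (hn : 0 < max f.natDegree g.natDegree) :
    (fiberPoly f g).natDegree = max f.natDegree g.natDegree := by
  rw [← map_integralFiberPoly, natDegree_map_eq_of_injective (IsFractionRing.injective _ _),
    natDegree_integralFiberPoly hn]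

theorem irreducible_fiberPoly {f g : k[X]} (hfg : IsCoprime f g)
    (hn : 0 < max f.natDegree g.natDegree) : Irreducible (fiberPoly f g) := by
  have hs : Bivariate.swap (integralFiberPoly f g) = C f - C g * X := by
    simp only [integralFiberPoly, map_sub, map_mul, Bivariate.swap_map_C, Bivariate.swap_X]
    ring
  have hg : g ≠ 0 := by
    rintro rfl
    have := natDegree_eq_zero_of_isUnit (isCoprime_zero_right.1 hfg)
    simp [this] at hn
  have h1 : Irreducible (Bivariate.swap (integralFiberPoly f g)) := by
    refine irreducible_of_degree_eq_one_of_isRelPrime_coeff ?_ ?_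
    · rw [hs, ← neg_sub, degree_neg, degree_sub_C (by simp [degree_C_mul_X hg])]
      exact degree_C_mul_X hg
    · have h0 : (Bivariate.swap (integralFiberPoly f g)).coeff 0 = f := by simp [hs]
      have h1 : (Bivariate.swap (integralFiberPoly f g)).coeff 1 = -g := by simp [hs, coeff_C]
      rw [h0, h1]
      exact hfg.neg_right.isRelPrime
  have h2 : Irreducible (integralFiberPoly f g) :=
    (MulEquiv.irreducible_iff (Bivariate.swap (R := k))).1 h1
  rw [← map_integralFiberPoly]
  refine ((h2.isPrimitive ?_).irreducible_iff_irreducible_map_fraction_map).1 h2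
  rw [natDegree_integralFiberPoly hn]
  omega

end irreducibility

section splitting

variable {F : Type} [Field F] {M : Type} [Field M] [Algebra F M] [Algebra (RatFunc F) M]
  [IsScalarTower F (RatFunc F) M] {f g : F[X]}

theorem aeval_fiberPoly (f g : F[X]) (x : M) :
    aeval x (fiberPoly f g) = aeval x f - algebraMap (RatFunc F) M RatFunc.X * aeval x g := by
  rw [fiberPoly, map_sub, map_mul, aeval_C, aeval_map_algebraMap, aeval_map_algebraMap]

theorem transcendental_algebraMap_X : Transcendental F (algebraMap (RatFunc F) M RatFunc.X) :=
  (transcendental_algebraMap_iff (algebraMap (RatFunc F) M).injective).2 RatFunc.transcendental_X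

theorem aeval_ne_zero_of_root (hfg : IsCoprime f g) {x : M} (hx : aeval x (fiberPoly f g) = 0) :
    aeval x g ≠ 0 := by
  intro h0
  rw [aeval_fiberPoly, h0, mul_zero, sub_zero] at hx
  obtain ⟨a, b, hab⟩ := hfg
  have := congrArg (aeval x) hab
  simp [h0, hx] at this

theorem eq_div_of_root (hfg : IsCoprime f g) {x : M} (hx : aeval x (fiberPoly f g) = 0) :
    algebraMap (RatFunc F) M RatFunc.X = aeval x f / aeval x g := by
  rw [eq_div_iff (aeval_ne_zero_of_root hfg hx)]
  rw [aeval_fiberPoly, sub_eq_zero] at hx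
  exact hx.symm

theorem transcendental_of_root (hfg : IsCoprime f g) {x : M}
    (hx : aeval x (fiberPoly f g) = 0) : Transcendental F x := by
  intro h
  refine transcendental_algebraMap_X (F := F) (M := M) ?_
  rw [eq_div_of_root hfg hx, div_eq_mul_inv]
  have h1 (r : F[X]) : IsAlgebraic F (aeval x r) := by
    by_contra hr
    exact (transcendental_aeval_iff.1 hr).1 h
  exact (h1 f).mul (h1 g).inv

theorem derivative_fiberPoly_ne_zero_of_root (hfg : IsCoprime f g)
    (hd : derivative f ≠ 0 ∨ derivative g ≠ 0) {x : M} (hx : aeval x (fiberPoly f g) = 0) :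
    aeval x (derivative f) ≠ algebraMap (RatFunc F) M RatFunc.X * aeval x (derivative g) := by
  intro h0
  have h1 := aeval_ne_zero_of_root hfg hx
  rw [eq_div_of_root hfg hx, div_mul_eq_mul_div, eq_div_iff h1, ← map_mul, ← map_mul] at h0
  have h2 : derivative f * g = f * derivative g :=
    transcendental_iff_injective.1 (transcendental_of_root hfg hx) h0
  have key (p r : F[X]) (h : IsCoprime p r) (hp : p ∣ derivative p * r) : derivative p = 0 := by
    by_contra h3
    have h4 := natDegree_le_of_dvd (h.dvd_of_dvd_mul_right hp) h3
    have h5 : p.natDegree ≠ 0 := fun h6 => h3 (by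
      rw [eq_C_of_natDegree_eq_zero h6, derivative_C])
    have := natDegree_derivative_lt h5
    omega
  rcases hd with hd | hd
  · exact hd (key f g hfg ⟨_, h2⟩)
  · exact hd (key g f hfg.symm ⟨derivative f, by rw [mul_comm, ← h2, mul_comm]⟩)

theorem separable_fiberPoly (hfg : IsCoprime f g) (hd : derivative f ≠ 0 ∨ derivative g ≠ 0) :
    (fiberPoly f g).Separable := by
  refine (isCoprime_iff_aeval_ne_zero_of_isAlgClosed (k := RatFunc F)
    (AlgebraicClosure (RatFunc F)) _ _).2 fun x => ?_
  by_contra! h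
  refine derivative_fiberPoly_ne_zero_of_root hfg hd h.1 ?_
  have h2 := h.2
  have h3 : derivative (fiberPoly f g) = fiberPoly (derivative f) (derivative g) := by
    simp [fiberPoly, derivative_map]
  rwa [h3, aeval_fiberPoly, sub_eq_zero] at h2

theorem exists_algEquiv_apply_eq [Normal (RatFunc F) M] (hfg : IsCoprime f g)
    (hn : 0 < max f.natDegree g.natDegree) {x x' : M} (hx : aeval x (fiberPoly f g) = 0)
    (hx' : aeval x' (fiberPoly f g) = 0) :
    ∃ σ : M ≃ₐ[RatFunc F] M, (∀ c, IsAlgebraic F c → σ c = c) ∧ σ x = x' := by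
  let k := algebraicClosure F M
  set t := algebraMap (RatFunc F) M RatFunc.X with ht
  have htk : Transcendental k t :=
    (transcendental_algebraMap_X (F := F) (M := M)).extendScalars k
  have hinj : Function.Injective (aeval t : k[X] →ₐ[k] M) := transcendental_iff_injective.1 htk
  have hle : nonZeroDivisors k[X] ≤
      Submonoid.comap (aeval t : k[X] →ₐ[k] M).toRingHom (nonZeroDivisors M) :=
    nonZeroDivisors_le_comap_nonZeroDivisors_of_injective _ hinj
  let _ : Algebra (RatFunc k) M := (RatFunc.liftRingHom _ hle).toAlgebra
  have hM (p : k[X]) : algebraMap (RatFunc k) M (algebraMap k[X] (RatFunc k) p) = aeval t p :=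
    RatFunc.liftRingHom_algebraMap _ hle p
  have : IsScalarTower k (RatFunc k) M := IsScalarTower.of_algebraMap_eq fun a => by
    have := hM (C a)
    rw [aeval_C] at this
    exact this.symm
  let ι : F[X] →+* RatFunc k :=
    (algebraMap k[X] (RatFunc k)).comp (mapRingHom (algebraMap F k))
  have hι : Function.Injective ι := (IsFractionRing.injective k[X] (RatFunc k)).comp
    (map_injective _ (algebraMap F k).injective)
  have hle' : nonZeroDivisors F[X] ≤ Submonoid.comap ι (nonZeroDivisors (RatFunc k)) :=
    nonZeroDivisors_le_comap_nonZeroDivisors_of_injective _ hι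
  let _ : Algebra (RatFunc F) (RatFunc k) := (RatFunc.liftRingHom ι hle').toAlgebra
  have : IsScalarTower (RatFunc F) (RatFunc k) M := by
    refine IsScalarTower.of_algebraMap_eq' ?_
    refine IsLocalization.ringHom_ext (nonZeroDivisors F[X]) ?_
    refine Polynomial.ringHom_ext (fun a => ?_) ?_
    · change algebraMap (RatFunc F) M (algebraMap F[X] (RatFunc F) (C a)) = algebraMap (RatFunc k) M
        (RatFunc.liftRingHom ι hle' (algebraMap F[X] (RatFunc F) (C a)))
      rw [RatFunc.liftRingHom_algebraMap]
      change _ = algebraMap (RatFunc k) M (algebraMap k[X] (RatFunc k) ((C a).map _))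
      rw [hM, map_C, aeval_C, ← IsScalarTower.algebraMap_apply F k M,
        IsScalarTower.algebraMap_apply F (RatFunc F) M]
      rfl
    · change algebraMap (RatFunc F) M (algebraMap F[X] (RatFunc F) X) = algebraMap (RatFunc k) M
        (RatFunc.liftRingHom ι hle' (algebraMap F[X] (RatFunc F) X))
      rw [RatFunc.liftRingHom_algebraMap, RatFunc.algebraMap_X]
      change _ = algebraMap (RatFunc k) M (algebraMap k[X] (RatFunc k) (X.map _))
      rw [hM, map_X, aeval_X]
  have : Normal (RatFunc k) M := Normal.tower_top_of_normal (RatFunc F) (RatFunc k) M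
  have hX : algebraMap (RatFunc k) M RatFunc.X = t := by
    rw [← RatFunc.algebraMap_X, hM, aeval_X]
  have hroot (z : M) (hz : aeval z (fiberPoly f g) = 0) :
      aeval z (fiberPoly (f.map (algebraMap F k)) (g.map (algebraMap F k))) = 0 := by
    rw [aeval_fiberPoly, hX, aeval_map_algebraMap, aeval_map_algebraMap, ← hz, aeval_fiberPoly]
  have hirr : Irreducible (fiberPoly (f.map (algebraMap F k)) (g.map (algebraMap F k))) :=
    irreducible_fiberPoly (hfg.map (mapRingHom (algebraMap F k)))
      (by rwa [natDegree_map, natDegree_map])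
  have hconj : IsConjRoot (RatFunc k) x' x := by
    rw [isConjRoot_def, ← minpoly.eq_of_irreducible hirr (hroot x hx),
      ← minpoly.eq_of_irreducible hirr (hroot x' hx')]
  obtain ⟨σ, hσ⟩ := isConjRoot_iff_exists_algEquiv.1 hconj
  refine ⟨σ.restrictScalars (RatFunc F), fun c hc => ?_, hσ⟩
  have h1 : c = algebraMap (RatFunc k) M
      (algebraMap k (RatFunc k) ⟨c, mem_algebraicClosure_iff.2 hc⟩) := by
    rw [← IsScalarTower.algebraMap_apply k (RatFunc k) M]
    rfl
  rw [h1]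
  exact σ.commutes _

end splitting

section counting

variable {G X : Type} [Group G] [MulAction G X] [Fintype X]

theorem sum_card_fixed_eq_card [Nonempty X] [DecidableEq X] (S : Finset G)
    (hS : ∀ x y : X, ∃ τ : G, τ • x = y ∧ ∀ σ, τ * σ ∈ S ↔ σ ∈ S) :
    ∑ σ ∈ S, (Finset.univ.filter fun x : X => σ • x = x).card = S.card := by
  have h1 (x y z : X) :
      (S.filter fun σ => σ • x = y).card = (S.filter fun σ => σ • x = z).card := by
    obtain ⟨τ, hτ, hτS⟩ := hS y z
    refine Finset.card_bij (fun σ _ => τ * σ) ?_ ?_ ?_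
    · intro σ hσ
      rw [Finset.mem_filter] at hσ ⊢
      exact ⟨(hτS σ).2 hσ.1, by rw [mul_smul, hσ.2, hτ]⟩
    · intro σ _ σ' _ h
      exact mul_left_cancel h
    · intro σ hσ
      rw [Finset.mem_filter] at hσ
      refine ⟨τ⁻¹ * σ, ?_, by rw [mul_inv_cancel_left]⟩
      rw [Finset.mem_filter, ← hτS, mul_inv_cancel_left, mul_smul, hσ.2, ← hτ, inv_smul_smul]
      exact ⟨hσ.1, rfl⟩
  have h2 : Fintype.card X * ∑ σ ∈ S, (Finset.univ.filter fun x : X => σ • x = x).card =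
      Fintype.card X * S.card := by
    simp only [Finset.card_filter]
    rw [Finset.sum_comm, Finset.mul_sum]
    calc ∑ x : X, Fintype.card X * ∑ σ ∈ S, (if σ • x = x then 1 else 0)
        = ∑ x : X, ∑ y : X, ∑ σ ∈ S, (if σ • x = y then 1 else 0) := by
          refine Finset.sum_congr rfl fun x _ => ?_
          rw [← Finset.card_univ, ← smul_eq_mul, ← Finset.sum_const]
          refine Finset.sum_congr rfl fun y _ => ?_
          simp only [← Finset.card_filter]
          exact h1 x x y
      _ = ∑ x : X, S.card := by
          refine Finset.sum_congr rfl fun x _ => ?_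
          rw [Finset.sum_comm]
          simp
      _ = Fintype.card X * S.card := by simp
  exact Nat.eq_of_mul_eq_mul_left Fintype.card_pos h2

theorem exists_two_fixed [Nonempty X] (S : Finset G)
    (hS : ∀ x y : X, ∃ τ : G, τ • x = y ∧ ∀ σ, τ * σ ∈ S ↔ σ ∈ S) {σ : G} (hσ : σ ∈ S)
    (hne : ¬ ∃! x : X, σ • x = x) :
    ∃ σ ∈ S, ∃ x y : X, x ≠ y ∧ σ • x = x ∧ σ • y = y := by
  classical
  by_contra! h
  have h1 (σ) (hσ : σ ∈ S) : (Finset.univ.filter fun x : X => σ • x = x).card ≤ 1 := by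
    rw [Finset.card_le_one]
    intro x hx y hy
    rw [Finset.mem_filter] at hx hy
    by_contra hxy
    exact h σ hσ x y hxy hx.2 hy.2
  have h2 : (Finset.univ.filter fun x : X => σ • x = x).card < 1 := by
    refine lt_of_le_of_ne (h1 σ hσ) fun h3 => hne ?_
    obtain ⟨x, hx⟩ := Finset.card_eq_one.1 h3
    refine ⟨x, ?_, fun y hy => ?_⟩
    · have := Finset.mem_singleton_self x
      rw [← hx, Finset.mem_filter] at this
      exact this.2
    · rw [← Finset.mem_singleton, ← hx, Finset.mem_filter]
      exact ⟨Finset.mem_univ _, hy⟩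
  have h3 := Finset.sum_lt_sum h1 ⟨σ, hσ, h2⟩
  rw [sum_card_fixed_eq_card S hS] at h3
  simp at h3

end counting

section action

variable {F : Type} [Field F] {M : Type} [Field M] [Algebra F M]

/-- The set of roots of `p`, with the action of the automorphisms of `M / F`. -/
def rootSubMulAction (p : F[X]) (M : Type) [Field M] [Algebra F M] :
    SubMulAction (M ≃ₐ[F] M) M where
  carrier := p.rootSet M
  smul_mem' σ x hx := by
    rw [mem_rootSet'] at hx ⊢
    exact ⟨hx.1, by rw [AlgEquiv.smul_def, aeval_algHom_apply, hx.2, map_zero]⟩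

theorem mem_rootSubMulAction {p : F[X]} (hp : p ≠ 0) {x : M} :
    x ∈ rootSubMulAction p M ↔ aeval x p = 0 :=
  mem_rootSet_of_ne hp

instance (p : F[X]) : Fintype (rootSubMulAction p M) :=
  inferInstanceAs (Fintype (p.rootSet M))

end action

theorem mem_range_algebraMap_of_pow_card_eq {F M : Type} [Field F] [Fintype F] [Field M]
    [Algebra F M] {x : M} (hx : x ^ Fintype.card F = x) : x ∈ (algebraMap F M).range := by
  have h0 := FiniteField.X_pow_card_sub_X_ne_zero F (Fintype.one_lt_card (α := F))
  refine Splits.mem_range_of_isRoot (f := X ^ Fintype.card F - X) ?_ h0 (by simp [hx])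
  rw [splits_iff_card_roots, FiniteField.roots_X_pow_card_sub_X,
    FiniteField.X_pow_card_sub_X_natDegree_eq F Fintype.one_lt_card]
  rfl

section splitting

variable {F : Type} [Field F] [Fintype F] {M : Type} [Field M] [Algebra F M]
  [Algebra (RatFunc F) M] [IsScalarTower F (RatFunc F) M] {f g : F[X]}

variable (F M) in
/-- The automorphisms of `M / F(t)` inducing the Frobenius on the constants. -/
def frobeniusCoset : Set (M ≃ₐ[RatFunc F] M) :=
  {σ | ∀ c : M, IsAlgebraic F c → σ c = c ^ Fintype.card F}

theorem existsUnique_fixed_of_injective [IsGalois (RatFunc F) M] [FiniteDimensional (RatFunc F) M]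
    (hfg : IsCoprime f g) (hd : derivative f ≠ 0 ∨ derivative g ≠ 0)
    (hn : 0 < max f.natDegree g.natDegree) (hsplit : ((fiberPoly f g).map (algebraMap _ M)).Splits)
    (hinj : ∀ a b : F, g.eval a * f.eval b = f.eval a * g.eval b → a = b)
    (hq : injectiveBound (max f.natDegree g.natDegree) ≤ Fintype.card F)
    {σ : M ≃ₐ[RatFunc F] M} (hσ : σ ∈ frobeniusCoset F M) :
    ∃! x, x ∈ (fiberPoly f g).rootSet M ∧ σ x = x := by
  classical
  by_contra hne
  have hirr := irreducible_fiberPoly hfg hn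
  let _ : Fintype (M ≃ₐ[RatFunc F] M) := Fintype.ofFinite _
  have : Nonempty (rootSubMulAction (fiberPoly f g) M) := by
    obtain ⟨x, hx⟩ := hsplit.exists_eval_eq_zero
      (by rw [degree_map]; exact (degree_pos_of_irreducible hirr).ne')
    exact ⟨x, (mem_rootSubMulAction hirr.ne_zero).2 (by rwa [aeval_def, ← eval_map])⟩
  obtain ⟨σ, hσ, x, y, hxy, hx, hy⟩ := exists_two_fixed
    (X := rootSubMulAction (fiberPoly f g) M) (Finset.univ.filter (· ∈ frobeniusCoset F M)) (by
      intro x y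
      obtain ⟨τ, hτ, hxy⟩ := exists_algEquiv_apply_eq hfg hn
        ((mem_rootSubMulAction hirr.ne_zero).1 x.2) ((mem_rootSubMulAction hirr.ne_zero).1 y.2)
      refine ⟨τ, Subtype.ext hxy, fun ρ => ?_⟩
      simp only [Finset.mem_filter, Finset.mem_univ, true_and]
      refine forall₂_congr fun c hc => ?_
      rw [AlgEquiv.mul_apply, hτ]
      exact hc.algHom (((ρ : M →ₐ[RatFunc F] M).restrictScalars F)))
    (σ := σ) (by simpa using hσ) (by
      rintro ⟨x, hx, hu⟩
      refine hne ⟨x, ⟨x.2, congrArg Subtype.val hx⟩, fun y hy => ?_⟩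
      exact congrArg Subtype.val (hu ⟨y, hy.1⟩ (Subtype.ext hy.2)))
  replace hσ : ∀ c : M, IsAlgebraic F c → σ c = c ^ Fintype.card F := (Finset.mem_filter.1 hσ).2
  replace hx : σ x = x := congrArg Subtype.val hx
  replace hy : σ y = y := congrArg Subtype.val hy
  have hx0 := (mem_rootSubMulAction hirr.ne_zero).1 x.2
  have hy0 := (mem_rootSubMulAction hirr.ne_zero).1 y.2
  let E := IntermediateField.fixedField (Subgroup.zpowers σ)
  have hmem {z : M} : z ∈ E ↔ σ z = z := by
    rw [IntermediateField.mem_fixedField_iff]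
    refine ⟨fun h => h σ (Subgroup.mem_zpowers σ), fun h τ hτ => ?_⟩
    have h1 : Subgroup.zpowers σ ≤ MulAction.stabilizer _ z :=
      Subgroup.zpowers_le.2 h
    exact h1 hτ
  have : IsScalarTower F E M := IsScalarTower.to₁₃₄ F (RatFunc F) E M
  have hval (z : E) (p : F[X]) : algebraMap E M (aeval z p) = aeval (z : M) p :=
    (aeval_algebraMap_apply M z p).symm
  have hval' : Function.Injective (algebraMap E M) := (algebraMap E M).injective
  refine (card_lt_injectiveBound (K := F) (E₀ := E) ?_ hfg rfl hn (x₁ := ⟨x, hmem.2 hx⟩)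
    (x₂ := ⟨y, hmem.2 hy⟩) ?_ ?_ ?_ ?_ hinj).not_ge hq
  · intro e he
    have h1 : IsAlgebraic F (e : M) := (he.map (IsScalarTower.toAlgHom F E M)).isAlgebraic
    obtain ⟨a, ha⟩ := mem_range_algebraMap_of_pow_card_eq ((hσ e h1).symm.trans (hmem.1 e.2))
    exact ⟨a, Subtype.ext ha⟩
  · exact fun h => hxy (Subtype.ext (Subtype.mk.inj h))
  · exact (transcendental_algebraMap_iff hval').1 (transcendental_of_root hfg hx0)
  · apply hval'
    rw [map_mul, map_mul, hval, hval, hval, hval]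
    have h1 := (eq_div_of_root hfg hx0).symm.trans (eq_div_of_root hfg hy0)
    rw [div_eq_div_iff (aeval_ne_zero_of_root hfg hx0) (aeval_ne_zero_of_root hfg hy0)] at h1
    rw [h1, mul_comm]
  · intro h
    have h := congrArg (algebraMap E M) h
    rw [map_mul, map_mul, hval, hval, hval, hval] at h
    apply derivative_fiberPoly_ne_zero_of_root hfg hd hy0
    rw [eq_div_of_root hfg hx0, div_mul_eq_mul_div, eq_div_iff (aeval_ne_zero_of_root hfg hx0),
      mul_comm]
    exact h

end splitting

section torsor

variable {G X : Type} [Group G] [MulAction G X] [DecidableEq X]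

theorem card_le_sum_card_fixed {S : Finset G}
    (hS : ∀ σ ∈ S, ∀ τ ∈ S, ∀ υ ∈ S, σ * τ⁻¹ * υ ∈ S) {A : Finset X} (hne : A.Nonempty)
    (hA : ∀ σ ∈ S, ∀ x ∈ A, σ • x ∈ A) (hfix : ∀ x ∈ A, ∃ σ ∈ S, σ • x = x) :
    S.card ≤ ∑ σ ∈ S, (A.filter fun x => σ • x = x).card := by
  obtain ⟨x₀, hx₀⟩ := hne
  have h1 : S.card = ∑ x ∈ A, (S.filter fun σ => σ • x₀ = x).card :=
    Finset.card_eq_sum_card_fiberwise fun σ hσ => hA σ hσ x₀ hx₀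
  have h2 : ∑ σ ∈ S, (A.filter fun x => σ • x = x).card =
      ∑ x ∈ A, (S.filter fun σ => σ • x = x).card := by
    simp only [Finset.card_filter]
    exact Finset.sum_comm
  rw [h1, h2]
  refine Finset.sum_le_sum fun x hx => ?_
  obtain ⟨τ, hτS, hτ⟩ := hfix x hx
  rcases (S.filter fun σ => σ • x₀ = x).eq_empty_or_nonempty with h | ⟨υ, hυ⟩
  · rw [h]
    exact Nat.zero_le _
  rw [Finset.mem_filter] at hυ
  refine Finset.card_le_card_of_injOn (fun σ => σ * υ⁻¹ * τ) (fun σ hσ => ?_)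
    (fun σ _ σ' _ h => mul_right_cancel (mul_right_cancel h))
  rw [Finset.mem_coe, Finset.mem_filter] at hσ ⊢
  refine ⟨hS _ hσ.1 _ hυ.1 _ hτS, ?_⟩
  rw [mul_smul, mul_smul, hτ, ← hσ.2, inv_smul_eq_iff.2, hσ.2]
  rw [hσ.2, hυ.2]

theorem exists_two_fixed_of_disjoint {S : Finset G} (hSne : S.Nonempty)
    (hS : ∀ σ ∈ S, ∀ τ ∈ S, ∀ υ ∈ S, σ * τ⁻¹ * υ ∈ S) {A A' : Finset X} (hd : Disjoint A A')
    (hne : A.Nonempty) (hA : ∀ σ ∈ S, ∀ x ∈ A, σ • x ∈ A) (hfix : ∀ x ∈ A, ∃ σ ∈ S, σ • x = x)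
    (hne' : A'.Nonempty) (hA' : ∀ σ ∈ S, ∀ x ∈ A', σ • x ∈ A')
    (hfix' : ∀ x ∈ A', ∃ σ ∈ S, σ • x = x) :
    ∃ σ ∈ S, ∃ x ∈ A ∪ A', ∃ y ∈ A ∪ A', x ≠ y ∧ σ • x = x ∧ σ • y = y := by
  by_contra! h
  have h1 (σ) (hσ : σ ∈ S) : ((A ∪ A').filter fun x => σ • x = x).card ≤ 1 := by
    rw [Finset.card_le_one]
    intro x hx y hy
    rw [Finset.mem_filter] at hx hy
    by_contra hxy
    exact h σ hσ x hx.1 y hy.1 hxy hx.2 hy.2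
  have h2 := Finset.sum_le_card_nsmul S _ 1 h1
  have h3 (σ : G) : ((A ∪ A').filter fun x => σ • x = x).card =
      (A.filter fun x => σ • x = x).card + (A'.filter fun x => σ • x = x).card := by
    rw [Finset.filter_union, Finset.card_union_of_disjoint (Finset.disjoint_filter_filter hd)]
  simp only [h3, Finset.sum_add_distrib, smul_eq_mul, mul_one] at h2
  have h4 := card_le_sum_card_fixed hS hne hA hfix
  have h5 := card_le_sum_card_fixed hS hne' hA' hfix'
  have h6 := hSne.card_pos
  omega

end torsor

section frobenius

variable {F B G : Type} [Field F] [Fintype F] [CommRing B] [Algebra F B] [Group G]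
  [MulSemiringAction G B]

variable (F G) in
/-- The elements of `G` inducing the `#F`-power map on `B ⧸ Q`. -/
def frobeniusAt (Q : Ideal B) : Set G := {σ | ∀ b : B, σ • b - b ^ Fintype.card F ∈ Q}

theorem exists_mem_frobeniusAt_smul_eq [Finite G] [SMulCommClass G F B] {Q : Ideal B}
    [Q.IsPrime] [Finite (B ⧸ Q)] {z : B}
    (hres : ∀ y : B, (∀ σ : G, σ • z = z → σ • y = y) → ∃ e : F, y - algebraMap F B e ∈ Q) :
    ∃ σ ∈ frobeniusAt F G Q, σ • z = z := by
  let H := MulAction.stabilizer G z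
  let R := FixedPoints.subalgebra F B H
  have : Algebra.IsInvariant R B H := ⟨fun b hb => ⟨⟨b, hb⟩, rfl⟩⟩
  have : SMulCommClass H R B := ⟨fun σ r b => by
    change σ • ((r : B) * b) = (r : B) * σ • b
    rw [smul_mul', r.2 σ]⟩
  obtain ⟨σ, hσ⟩ := IsArithFrobAt.exists_of_isInvariant R H Q
  refine ⟨σ, fun b => ?_, σ.2⟩
  have hcard : Nat.card (R ⧸ Q.under R) = Fintype.card F := by
    rw [← Nat.card_eq_fintype_card]
    refine (Nat.card_eq_of_bijective (algebraMap F (R ⧸ Q.under R))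
      ⟨(algebraMap F (R ⧸ Q.under R)).injective, fun y => ?_⟩).symm
    obtain ⟨y, rfl⟩ := Ideal.Quotient.mk_surjective y
    obtain ⟨e, he⟩ := hres y (fun σ hσ => y.2 ⟨σ, hσ⟩)
    refine ⟨e, Eq.symm (Ideal.Quotient.eq.2 ?_)⟩
    exact he
  have := hσ b
  rwa [hcard] at this

theorem smul_sub_algebraMap_mem {Q : Ideal B} {σ : G} (hσ : σ ∈ frobeniusAt F G Q) {z : B} {a : F}
    (hz : z - algebraMap F B a ∈ Q) : σ • z - algebraMap F B a ∈ Q := by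
  have h1 : z ^ Fintype.card F - algebraMap F B a ∈ Q := by
    have := Q.mem_of_dvd (sub_dvd_pow_sub_pow z (algebraMap F B a) (Fintype.card F)) hz
    rwa [← map_pow, FiniteField.pow_card] at this
  convert Q.add_mem (hσ z) h1 using 1
  ring

theorem mul_inv_mul_mem_frobeniusAt {F B G : Type} [Fintype F] [CommRing B] [Group G]
    [MulSemiringAction G B] {Q : Ideal B} {σ τ υ : G} (hσ : σ ∈ frobeniusAt F G Q)
    (hτ : τ ∈ frobeniusAt F G Q) (hυ : υ ∈ frobeniusAt F G Q) :
    σ * τ⁻¹ * υ ∈ frobeniusAt F G Q := by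
  intro b
  have h := Q.add_mem (Q.sub_mem (hσ (τ⁻¹ • υ • b)) (hτ (τ⁻¹ • υ • b))) (hυ b)
  rw [smul_inv_smul] at h
  rw [mul_smul, mul_smul]
  convert h using 1
  ring

theorem exists_mem_frobeniusAt_two_fixed [Finite G] [SMulCommClass G F B] {Q : Ideal B}
    [Q.IsPrime] [Finite (B ⧸ Q)]
    {Z : Finset B} (hZ : ∀ σ : G, ∀ z ∈ Z, σ • z ∈ Z)
    (hres : ∀ z ∈ Z, ∀ a : F, z - algebraMap F B a ∈ Q → ∀ y : B,
      (∀ σ : G, σ • z = z → σ • y = y) → ∃ e : F, y - algebraMap F B e ∈ Q)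
    {a b : F} (hab : a ≠ b) (ha : ∏ z ∈ Z, (algebraMap F B a - z) ∈ Q)
    (hb : ∏ z ∈ Z, (algebraMap F B b - z) ∈ Q) :
    ∃ σ ∈ frobeniusAt F G Q, ∃ x ∈ Z, ∃ y ∈ Z, x ≠ y ∧ σ • x = x ∧ σ • y = y := by
  classical
  let _ : Fintype G := Fintype.ofFinite G
  let S : Finset G := Finset.univ.filter (· ∈ frobeniusAt F G Q)
  have hS (σ : G) : σ ∈ S ↔ σ ∈ frobeniusAt F G Q := by simp [S]
  let A (a : F) : Finset B := Z.filter fun z => z - algebraMap F B a ∈ Q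
  have hne (a : F) (ha : ∏ z ∈ Z, (algebraMap F B a - z) ∈ Q) : (A a).Nonempty := by
    obtain ⟨z, hz, hzQ⟩ := (Ideal.IsPrime.prod_mem_iff).1 ha
    exact ⟨z, Finset.mem_filter.2 ⟨hz, by rwa [← neg_mem_iff, neg_sub]⟩⟩
  have hA (a : F) : ∀ σ ∈ S, ∀ x ∈ A a, σ • x ∈ A a := by
    intro σ hσ x hx
    rw [Finset.mem_filter] at hx ⊢
    exact ⟨hZ σ x hx.1, smul_sub_algebraMap_mem ((hS σ).1 hσ) hx.2⟩
  have hfix (a : F) : ∀ x ∈ A a, ∃ σ ∈ S, σ • x = x := by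
    intro x hx
    rw [Finset.mem_filter] at hx
    obtain ⟨σ, hσ, h⟩ := exists_mem_frobeniusAt_smul_eq (hres x hx.1 a hx.2)
    exact ⟨σ, (hS σ).2 hσ, h⟩
  have hd : Disjoint (A a) (A b) := by
    rw [Finset.disjoint_filter]
    intro z _ h1 h2
    have h3 := Q.sub_mem h1 h2
    rw [sub_sub_sub_cancel_left, ← map_sub] at h3
    exact (Ideal.IsPrime.ne_top ‹_›) (Q.eq_top_of_isUnit_mem h3
      ((IsUnit.mk0 _ (sub_ne_zero.2 hab.symm)).map (algebraMap F B)))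
  obtain ⟨z, hz⟩ := hne a ha
  obtain ⟨σ₀, hσ₀, -⟩ := hfix a z hz
  obtain ⟨σ, hσ, x, hx, y, hy, h⟩ := exists_two_fixed_of_disjoint ⟨σ₀, hσ₀⟩
    (fun σ hσ τ hτ υ hυ => (hS _).2
      (mul_inv_mul_mem_frobeniusAt ((hS σ).1 hσ) ((hS τ).1 hτ) ((hS υ).1 hυ)))
    hd (hne a ha) (hA a) (hfix a) (hne b hb) (hA b) (hfix b)
  have hsub : A a ∪ A b ⊆ Z :=
    Finset.union_subset (Finset.filter_subset _ _) (Finset.filter_subset _ _)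
  exact ⟨σ, (hS σ).1 hσ, x, hsub hx, y, hsub hy, h⟩

end frobenius

theorem exists_eq_mul_isCoprime {F : Type} [Field F] (r : F[X]) {u : F[X]} (hu : u ≠ 0) :
    ∃ d r' u' : F[X], r = d * r' ∧ u = d * u' ∧ IsCoprime r' u' := by
  classical
  let _ : GCDMonoid F[X] := EuclideanDomain.gcdMonoid F[X]
  have h : gcd r u ≠ 0 := gcd_ne_zero_of_right hu
  exact ⟨gcd r u, r / gcd r u, u / gcd r u,
    (EuclideanDomain.mul_div_cancel' h (gcd_dvd_left r u)).symm,
    (EuclideanDomain.mul_div_cancel' h (gcd_dvd_right r u)).symm, isCoprime_div_gcd_div_gcd hu⟩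

theorem aeval_sub_algebraMap_eval_mem {F B : Type} [Field F] [CommRing B] [Algebra F B]
    {Q : Ideal B} {z : B} {a : F} (hz : z - algebraMap F B a ∈ Q) (p : F[X]) :
    aeval z p - algebraMap F B (p.eval a) ∈ Q := by
  have h := sub_dvd_eval_sub z (algebraMap F B a) (p.map (algebraMap F B))
  rw [eval_map_algebraMap, eval_map_algebraMap, aeval_algebraMap_apply_eq_algebraMap_eval] at h
  exact Q.mem_of_dvd h hz

theorem exists_sub_algebraMap_mem {F B : Type} [Field F] [CommRing B] [Algebra F B] {Q : Ideal B}
    [Q.IsPrime] {z y : B} {a : F} (hz : z - algebraMap F B a ∈ Q) {r u : F[X]}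
    (hru : IsCoprime r u) (hy : y * aeval z u = aeval z r) : ∃ e : F, y - algebraMap F B e ∈ Q := by
  have hQ {c : F} (hc : algebraMap F B c ∈ Q) : c = 0 := by
    by_contra h
    exact Ideal.IsPrime.ne_top ‹_› (Q.eq_top_of_isUnit_mem hc ((IsUnit.mk0 c h).map _))
  have h1 := aeval_sub_algebraMap_eval_mem hz u
  have h2 := aeval_sub_algebraMap_eval_mem hz r
  have hua : u.eval a ≠ 0 := by
    intro h0
    rw [h0, map_zero, sub_zero] at h1
    have h3 : r.eval a = 0 := by
      apply hQ
      rw [← hy] at h2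
      convert Q.sub_mem (Q.mul_mem_left y h1) h2 using 1
      ring
    obtain ⟨v, w, h⟩ := hru
    simpa [h0, h3] using congrArg (eval a) h
  refine ⟨r.eval a / u.eval a, ?_⟩
  have h4 : algebraMap F B (r.eval a / u.eval a) * algebraMap F B (u.eval a) =
      algebraMap F B (r.eval a) := by
    rw [← map_mul, div_mul_cancel₀ _ hua]
  have h5 : (y - algebraMap F B (r.eval a / u.eval a)) * algebraMap F B (u.eval a) ∈ Q := by
    rw [sub_mul, h4]
    convert Q.sub_mem h2 (Q.mul_mem_left y h1) using 1
    rw [← hy]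
    ring
  exact (Ideal.IsPrime.mem_or_mem ‹_› h5).resolve_right fun h => hua (hQ h)

section subalgebra

variable {F M G : Type} [Field F] [Field M] [Algebra F M] [Group G] [MulSemiringAction G M]

/-- The action of `G` on a `G`-stable subalgebra. -/
abbrev mulSemiringActionOfStable (B : Subalgebra F M) (h : ∀ σ : G, ∀ b ∈ B, σ • b ∈ B) :
    MulSemiringAction G B where
  smul σ b := ⟨σ • (b : M), h σ b b.2⟩
  one_smul b := Subtype.ext (one_smul G (b : M))
  mul_smul σ τ b := Subtype.ext (mul_smul σ τ (b : M))
  smul_zero σ := Subtype.ext (smul_zero σ)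
  smul_add σ b c := Subtype.ext (smul_add σ (b : M) c)
  smul_one σ := Subtype.ext (smul_one σ)
  smul_mul σ b c := Subtype.ext (smul_mul' σ (b : M) c)

theorem smul_mem_adjoin [SMulCommClass G F M] {S : Set M} (hS : ∀ σ : G, ∀ x ∈ S, σ • x ∈ S)
    (σ : G) {b : M} (hb : b ∈ Algebra.adjoin F S) : σ • b ∈ Algebra.adjoin F S := by
  have : Algebra.adjoin F S ≤ (Algebra.adjoin F S).comap (MulSemiringAction.toAlgHom F M σ) :=
    Algebra.adjoin_le fun x hx => Algebra.subset_adjoin (hS σ x hx)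
  exact this hb

/-- If every element of `S` is integral over `F[s]`, with `s` transcendental, then `s` lies in some
maximal ideal of `F[s, S]`. -/
theorem exists_isMaximal_mem {s : M} (hs : Transcendental F s) {S : Set M}
    (hinteg : ∀ z ∈ S, (aeval s : F[X] →ₐ[F] M).toRingHom.IsIntegralElem z)
    (hsS : s ∈ Algebra.adjoin F S) :
    ∃ Q : Ideal (Algebra.adjoin F S), Q.IsMaximal ∧ ⟨s, hsS⟩ ∈ Q := by
  let B := Algebra.adjoin F S
  let φ : F[X] →ₐ[F] B := aeval ⟨s, hsS⟩
  have hφ (p : F[X]) : (φ p : M) = aeval s p := (aeval_algebraMap_apply M (⟨s, hsS⟩ : B) p).symm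
  let _ : Algebra F[X] B := φ.toRingHom.toAlgebra
  have hB (b : M) (hb : b ∈ B) : (aeval s : F[X] →ₐ[F] M).toRingHom.IsIntegralElem b := by
    refine Algebra.adjoin_induction (fun z hz => hinteg z hz) (fun c => ?_)
      (fun x y _ _ hx hy => hx.add _ hy) (fun x y _ _ hx hy => hx.mul _ hy) hb
    have := (aeval s : F[X] →ₐ[F] M).toRingHom.isIntegralElem_map (x := C c)
    simpa using this
  have : Algebra.IsIntegral F[X] B := ⟨fun b => by
    obtain ⟨p, hp, h⟩ := hB b b.2
    refine ⟨p, hp, Subtype.ext ?_⟩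
    have hcomp : (B.val : B →+* M).comp φ.toRingHom = (aeval s : F[X] →ₐ[F] M).toRingHom :=
      RingHom.ext hφ
    exact (hom_eval₂ p φ.toRingHom (B.val : B →+* M) b).trans (by rw [hcomp]; exact h)⟩
  have hX : (Ideal.span {(X : F[X])}).IsMaximal :=
    PrincipalIdealRing.isMaximal_of_irreducible irreducible_X
  obtain ⟨Q, hQ, hQX⟩ := Ideal.exists_ideal_over_maximal_of_isIntegral (S := B)
    (Ideal.span {(X : F[X])}) (by
      intro p hp
      have : aeval s p = 0 := by
        rw [← hφ]
        exact congrArg Subtype.val hp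
      rw [transcendental_iff.1 hs p this]
      exact zero_mem _)
  refine ⟨Q, hQ, ?_⟩
  have h1 : X ∈ Q.comap (algebraMap F[X] B) := by
    rw [hQX]
    exact Ideal.mem_span_singleton_self _
  rw [Ideal.mem_comap] at h1
  convert h1
  exact ((hφ X).trans (aeval_X _)).symm

theorem exists_two_fixed_of_prod_eq_mul [Fintype F] [Finite G] [SMulCommClass G F M]
    {s : M} (hs : Transcendental F s) (hsG : ∀ σ : G, σ • s = s) {Z T : Finset M}
    (hZ : ∀ σ : G, ∀ z ∈ Z, σ • z ∈ Z) (hT : ∀ σ : G, ∀ c ∈ T, σ • c ∈ T)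
    (hTalg : ∀ c ∈ T, IsAlgebraic F c)
    (hinteg : ∀ z ∈ Z, (aeval s : F[X] →ₐ[F] M).toRingHom.IsIntegralElem z)
    (hfix : ∀ z ∈ Z, ∀ y : M, (∀ σ : G, σ • z = z → σ • y = y) → y ∈ IntermediateField.adjoin F {z})
    {a b : F} (hab : a ≠ b) (ha : ∃ e : F, ∏ z ∈ Z, (algebraMap F M a - z) = s * algebraMap F M e)
    (hb : ∃ e : F, ∏ z ∈ Z, (algebraMap F M b - z) = s * algebraMap F M e) :
    ∃ σ : G, (∀ c ∈ T, σ • c = c ^ Fintype.card F) ∧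
      ∃ x ∈ Z, ∃ y ∈ Z, x ≠ y ∧ σ • x = x ∧ σ • y = y := by
  classical
  let S : Finset M := insert s (Z ∪ T)
  have hS : ∀ σ : G, ∀ x ∈ (S : Set M), σ • x ∈ (S : Set M) := by
    intro σ x hx
    simp only [S, Finset.mem_coe, Finset.mem_insert, Finset.mem_union] at hx ⊢
    rcases hx with rfl | hx | hx
    · exact Or.inl (hsG σ)
    · exact Or.inr (Or.inl (hZ σ x hx))
    · exact Or.inr (Or.inr (hT σ x hx))
  let B := Algebra.adjoin F (S : Set M)
  have hsub (x : M) (hx : x ∈ S) : x ∈ B := Algebra.subset_adjoin hx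
  have hsB : s ∈ B := hsub s (Finset.mem_insert_self _ _)
  have hZB (z : M) (hz : z ∈ Z) : z ∈ B :=
    hsub z (Finset.mem_insert_of_mem (Finset.mem_union_left _ hz))
  have hTB (c : M) (hc : c ∈ T) : c ∈ B :=
    hsub c (Finset.mem_insert_of_mem (Finset.mem_union_right _ hc))
  let _ : MulSemiringAction G B :=
    mulSemiringActionOfStable B fun σ b hb => smul_mem_adjoin hS σ hb
  have : SMulCommClass G F B := ⟨fun σ c b => Subtype.ext (smul_comm σ c (b : M))⟩
  obtain ⟨Q, hQ, hsQ⟩ := exists_isMaximal_mem hs (S := (S : Set M)) (by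
    intro x hx
    simp only [S, Finset.mem_coe, Finset.mem_insert, Finset.mem_union] at hx
    rcases hx with rfl | hx | hx
    · have := (aeval x : F[X] →ₐ[F] M).toRingHom.isIntegralElem_map (x := X)
      simpa using this
    · exact hinteg x hx
    · obtain ⟨p, hp, h⟩ := (hTalg x hx).isIntegral
      refine ⟨p.map C, hp.map C, ?_⟩
      have hcomp : (aeval s : F[X] →ₐ[F] M).toRingHom.comp C = algebraMap F M :=
        RingHom.ext fun c => aeval_C _ c
      rw [eval₂_map, hcomp]
      exact h) hsB
  let _ : Field (B ⧸ Q) := Ideal.Quotient.field Q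
  have : Algebra.FiniteType F B :=
    (Subalgebra.fg_iff_finiteType _).1 (Subalgebra.fg_adjoin_finset S)
  have : Algebra.FiniteType F (B ⧸ Q) :=
    Algebra.FiniteType.of_surjective (Ideal.Quotient.mkₐ F Q) Ideal.Quotient.mk_surjective
  have : Module.Finite F (B ⧸ Q) := finite_of_finite_type_of_isJacobsonRing F (B ⧸ Q)
  have : Finite (B ⧸ Q) := Module.finite_of_finite F
  have hprod (a : F) (ha : ∃ e : F, ∏ z ∈ Z, (algebraMap F M a - z) = s * algebraMap F M e) :
      ∏ z ∈ Z.subtype (· ∈ B), (algebraMap F B a - z) ∈ Q := by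
    obtain ⟨e, he⟩ := ha
    have h1 : ∏ z ∈ Z.subtype (· ∈ B), (algebraMap F B a - z) = ⟨s, hsB⟩ * algebraMap F B e := by
      apply Subtype.ext
      change B.val (∏ z ∈ Z.subtype (· ∈ B), (algebraMap F B a - z)) = s * algebraMap F M e
      rw [map_prod, ← he, ← Finset.prod_subtype_of_mem _ hZB]
      rfl
    rw [h1]
    exact Q.mul_mem_right _ hsQ
  obtain ⟨σ, hσ, x, hx, y, hy, hxy, hσx, hσy⟩ := exists_mem_frobeniusAt_two_fixed (G := G) (Q := Q)
    (Z := Z.subtype (· ∈ B)) (fun σ z hz => by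
      rw [Finset.mem_subtype] at hz ⊢
      exact hZ σ z hz) (fun z hz c hc y hy => by
      rw [Finset.mem_subtype] at hz
      have h1 := hfix z hz y fun σ hσ => congrArg Subtype.val (hy σ (Subtype.ext hσ))
      obtain ⟨r, u, hru⟩ := (IntermediateField.mem_adjoin_simple_iff F _).1 h1
      by_cases hu : aeval (z : M) u = 0
      · refine ⟨0, ?_⟩
        have : y = 0 := Subtype.ext (by rw [hru, hu, div_zero]; rfl)
        rw [this, map_zero, sub_zero]
        exact zero_mem _
      · obtain ⟨d, r', u', rfl, rfl, hcop⟩ :=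
          exists_eq_mul_isCoprime r (u := u) (by rintro rfl; simp at hu)
        refine exists_sub_algebraMap_mem hc hcop (Subtype.ext ?_)
        change (y : M) * B.val (aeval z u') = B.val (aeval z r')
        rw [← aeval_algHom_apply, ← aeval_algHom_apply]
        change (y : M) * aeval (z : M) u' = aeval (z : M) r'
        rw [map_mul] at hu
        rw [hru, map_mul, map_mul, mul_div_mul_left _ _ (left_ne_zero_of_mul hu),
          div_mul_cancel₀ _ (right_ne_zero_of_mul hu)])
    hab (hprod a ha) (hprod b hb)
  refine ⟨σ, fun c hc => ?_, x, Finset.mem_subtype.1 hx, y, Finset.mem_subtype.1 hy,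
    fun h => hxy (Subtype.ext h), congrArg Subtype.val hσx, congrArg Subtype.val hσy⟩
  by_contra hne
  have h1 := hσ ⟨c, hTB c hc⟩
  set d : B := σ • (⟨c, hTB c hc⟩ : B) - ⟨c, hTB c hc⟩ ^ Fintype.card F with hd
  have hdM : (d : M) = σ • c - c ^ Fintype.card F := rfl
  have hd0 : (d : M) ≠ 0 := by rwa [hdM, sub_ne_zero]
  have hda : IsAlgebraic F (d : M) := by
    rw [hdM]
    exact (hTalg _ (hT σ c hc)).sub ((hTalg c hc).pow _)
  have hinv := B.inv_mem_of_algebraic hda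
  refine hQ.ne_top (Q.eq_top_of_isUnit_mem h1 (IsUnit.of_mul_eq_one ⟨_, hinv⟩ (Subtype.ext ?_)))
  exact mul_inv_cancel₀ hd0

end subalgebra

section projective

variable {F : Type} [Field F]

/-- The value at a point of `ℙ¹(F)` of the homogenization in degree `n` of a polynomial. -/
def evalProj (n : ℕ) (p : F[X]) : Option F → F
  | some a => p.eval a
  | none => p.coeff n

/-- The coordinate `1 / (x - c)` on `ℙ¹(F)`. -/
def invCoord (c : F) : Option F → F
  | some a => (a - c)⁻¹
  | none => 0

theorem invCoord_injOn (c : F) : Set.InjOn (invCoord c) {some c}ᶜ := by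
  rintro (_ | a) ha (_ | b) hb h
  · rfl
  · exact absurd (sub_eq_zero.1 (inv_eq_zero.1 h.symm)) (by simpa using hb)
  · exact absurd (sub_eq_zero.1 (inv_eq_zero.1 h)) (by simpa using ha)
  · simpa [invCoord] using h

end projective

/-- If `p(z) = s r(z)` with `deg p > deg r`, then `z` is integral over `F[s]`. -/
theorem isIntegralElem_of_aeval_eq_mul {F M : Type} [Field F] [Field M] [Algebra F M] {s z : M}
    {p r : F[X]} (hrp : r.degree < p.degree) (h : aeval z p = s * aeval z r) :
    (aeval s : F[X] →ₐ[F] M).toRingHom.IsIntegralElem z := by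
  have hp : p ≠ 0 := by
    rintro rfl
    simp at hrp
  have hu : p.leadingCoeff⁻¹ ≠ 0 := inv_ne_zero (leadingCoeff_ne_zero.2 hp)
  have hcomp : (aeval s : F[X] →ₐ[F] M).toRingHom.comp C = algebraMap F M :=
    RingHom.ext fun c => aeval_C _ c
  refine ⟨(p * C p.leadingCoeff⁻¹).map C - C X * (r * C p.leadingCoeff⁻¹).map C, ?_, ?_⟩
  · refine ((monic_mul_leadingCoeff_inv hp).map C).sub_of_left ?_
    rw [degree_C_mul X_ne_zero, degree_map_eq_of_injective C_injective,
      degree_map_eq_of_injective C_injective, degree_mul_C hu, degree_mul_C hu]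
    exact hrp
  · rw [eval₂_sub, eval₂_mul, eval₂_C, eval₂_map, eval₂_map, hcomp, ← aeval_def, ← aeval_def,
      map_mul, map_mul, h]
    have : (aeval s : F[X] →ₐ[F] M).toRingHom X = s := aeval_X s
    rw [this]
    ring

theorem isIntegralElem_inv_sub {F M : Type} [Field F] [Field M] [Algebra F M] {s x : M}
    {p r : F[X]} {n : ℕ} (hp : p.natDegree ≤ n) (hr : r.natDegree ≤ n) {c : F}
    (hpc : p.eval c ≠ 0) (hrc : r.eval c = 0) (hx : x ≠ algebraMap F M c)
    (h : aeval x p = s * aeval x r) :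
    (aeval s : F[X] →ₐ[F] M).toRingHom.IsIntegralElem (x - algebraMap F M c)⁻¹ := by
  have hx' : x - algebraMap F M c ≠ 0 := sub_ne_zero.2 hx
  have hval (p : F[X]) (hp : p.natDegree ≤ n) :
      aeval (x - algebraMap F M c)⁻¹ (reflect n (taylor c p)) * (x - algebraMap F M c) ^ n =
        aeval x p := by
    let _ : Invertible (x - algebraMap F M c) := invertibleOfNonzero hx'
    rw [aeval_def, ← invOf_eq_inv, eval₂_reflect_mul_pow _ _ _ _ (by rwa [natDegree_taylor]),
      ← aeval_def, taylor_apply, aeval_comp]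
    simp
  refine isIntegralElem_of_aeval_eq_mul (p := reflect n (taylor c p))
    (r := reflect n (taylor c r)) ?_ (mul_right_cancel₀ (pow_ne_zero n hx') ?_)
  · have h1 : (reflect n (taylor c p)).coeff n ≠ 0 := by
      rwa [coeff_reflect, revAt_le le_rfl, Nat.sub_self, taylor_coeff_zero]
    refine lt_of_lt_of_le ?_ (le_degree_of_ne_zero h1)
    rw [degree_lt_iff_coeff_zero]
    intro m hm
    rcases hm.eq_or_lt with rfl | hm
    · rw [coeff_reflect, revAt_le le_rfl, Nat.sub_self, taylor_coeff_zero, hrc]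
    · rw [coeff_reflect, revAt_eq_self_of_lt hm, coeff_eq_zero_of_natDegree_lt]
      rw [natDegree_taylor]
      omega
  · rw [mul_assoc, hval p hp, hval r hr, h]

theorem aeval_fiberPoly_eq_prod {F : Type} [Field F] {M : Type} [Field M]
    [Algebra (RatFunc F) M] [DecidableEq M] {f g : F[X]} (hsep : (fiberPoly f g).Separable)
    (hsplit : ((fiberPoly f g).map (algebraMap _ M)).Splits) (y : M) :
    aeval y (fiberPoly f g) = algebraMap (RatFunc F) M (fiberPoly f g).leadingCoeff *
      ∏ x ∈ ((fiberPoly f g).aroots M).toFinset, (y - x) := by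
  have h1 : ((fiberPoly f g).aroots M).Nodup := nodup_roots hsep.map
  conv_lhs => rw [aeval_def, ← eval_map, hsplit.eq_prod_roots]
  rw [eval_mul, eval_C, leadingCoeff_map, eval_multiset_prod, Multiset.map_map,
    Finset.prod_eq_multiset_prod, Multiset.toFinset_val, h1.dedup]
  simp

section splitting

variable {F : Type} [Field F] {M : Type} [Field M] [Algebra F M]
  [Algebra (RatFunc F) M] [IsScalarTower F (RatFunc F) M] {f g : F[X]}

theorem leadingCoeff_fiberPoly (hn : 0 < max f.natDegree g.natDegree) :
    (fiberPoly f g).leadingCoeff =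
      algebraMap F (RatFunc F) (f.coeff (max f.natDegree g.natDegree)) -
      RatFunc.X * algebraMap F (RatFunc F) (g.coeff (max f.natDegree g.natDegree)) := by
  rw [leadingCoeff, natDegree_fiberPoly hn, fiberPoly, coeff_sub, coeff_C_mul, coeff_map, coeff_map]

theorem sub_X_mul_ne_zero {a b : F} (h : a ≠ 0 ∨ b ≠ 0) :
    algebraMap F M a - algebraMap (RatFunc F) M RatFunc.X * algebraMap F M b ≠ 0 := by
  intro h0
  have h1 := transcendental_iff.1 (transcendental_algebraMap_X (F := F) (M := M)) (C a - X * C b)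
    (by
      rw [map_sub, map_mul, aeval_C, aeval_C, aeval_X]
      exact h0)
  have h2 := congrArg (fun p => coeff p 0) h1
  have h3 := congrArg (fun p => coeff p 1) h1
  simp [coeff_C] at h2 h3
  tauto

theorem prod_invCoord_sub [DecidableEq M] (hsep : (fiberPoly f g).Separable)
    (hsplit : ((fiberPoly f g).map (algebraMap _ M)).Splits) (hfg : IsCoprime f g)
    (hn : 0 < max f.natDegree g.natDegree) {c : F} {P : Option F} (hP : P ≠ some c) :
    ∃ e : F, ∏ x ∈ ((fiberPoly f g).aroots M).toFinset,
      (algebraMap F M (invCoord c P) - (x - algebraMap F M c)⁻¹) =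
      (algebraMap F M (evalProj (max f.natDegree g.natDegree) f P) -
        algebraMap (RatFunc F) M RatFunc.X *
          algebraMap F M (evalProj (max f.natDegree g.natDegree) g P)) /
      (algebraMap F M (f.eval c) -
        algebraMap (RatFunc F) M RatFunc.X * algebraMap F M (g.eval c)) * algebraMap F M e := by
  set R := ((fiberPoly f g).aroots M).toFinset with hR
  have h0 : fiberPoly f g ≠ 0 := hsep.ne_zero
  have hL : algebraMap (RatFunc F) M (fiberPoly f g).leadingCoeff ≠ 0 :=
    (_root_.map_ne_zero _).2 (leadingCoeff_ne_zero.2 h0)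
  have hev (y : F) : algebraMap F M (f.eval y) - algebraMap (RatFunc F) M RatFunc.X *
      algebraMap F M (g.eval y) = algebraMap (RatFunc F) M (fiberPoly f g).leadingCoeff *
      ∏ x ∈ R, (algebraMap F M y - x) := by
    rw [hR, ← aeval_fiberPoly_eq_prod hsep hsplit, aeval_fiberPoly,
      aeval_algebraMap_apply_eq_algebraMap_eval, aeval_algebraMap_apply_eq_algebraMap_eval]
  have hxR (x : M) (hx : x ∈ R) (y : F) : algebraMap F M y - x ≠ 0 := by
    rw [hR, Multiset.mem_toFinset, mem_aroots] at hx
    rw [sub_ne_zero]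
    rintro rfl
    exact transcendental_of_root hfg hx.2 (isAlgebraic_algebraMap y)
  have hprod (y : F) : ∏ x ∈ R, (algebraMap F M y - x) ≠ 0 :=
    Finset.prod_ne_zero_iff.2 fun x hx => hxR x hx y
  rcases P with _ | a
  · refine ⟨1, ?_⟩
    have hlead : algebraMap F M (f.coeff (max f.natDegree g.natDegree)) -
        algebraMap (RatFunc F) M RatFunc.X *
          algebraMap F M (g.coeff (max f.natDegree g.natDegree)) =
        algebraMap (RatFunc F) M (fiberPoly f g).leadingCoeff := by
      rw [leadingCoeff_fiberPoly hn, map_sub, map_mul, ← IsScalarTower.algebraMap_apply,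
        ← IsScalarTower.algebraMap_apply]
    simp only [invCoord, evalProj, map_zero, zero_sub, map_one, mul_one]
    rw [hlead, hev c, ← div_div, div_self hL, one_div, ← Finset.prod_inv_distrib]
    refine Finset.prod_congr rfl fun x _ => ?_
    rw [← inv_neg, neg_sub]
  · have hac : algebraMap F M a - algebraMap F M c ≠ 0 := by
      rw [← map_sub, _root_.map_ne_zero, sub_ne_zero]
      rintro rfl
      exact hP rfl
    refine ⟨(a - c)⁻¹ ^ R.card, ?_⟩
    simp only [invCoord, evalProj]
    rw [hev a, hev c, mul_div_mul_left _ _ hL, ← Finset.prod_div_distrib, map_pow,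
      ← Finset.prod_const, ← Finset.prod_mul_distrib]
    refine Finset.prod_congr rfl fun x hx => ?_
    have h1 := hxR x hx c
    have h2 : x - algebraMap F M c ≠ 0 := sub_ne_zero.2 (sub_ne_zero.1 h1).symm
    rw [map_inv₀, map_sub]
    field_simp
    ring

theorem mem_adjoin_of_forall_fixed [IsGalois (RatFunc F) M] [FiniteDimensional (RatFunc F) M]
    (hfg : IsCoprime f g) {x : M} (hx : aeval x (fiberPoly f g) = 0) {y : M}
    (hy : ∀ σ : M ≃ₐ[RatFunc F] M, σ x = x → σ y = y) : y ∈ IntermediateField.adjoin F {x} := by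
  have h1 : y ∈ IntermediateField.adjoin (RatFunc F) {x} := by
    rw [← IsGalois.fixedField_fixingSubgroup (IntermediateField.adjoin (RatFunc F) {x}),
      IntermediateField.mem_fixedField_iff]
    intro σ hσ
    rw [IntermediateField.mem_fixingSubgroup_iff] at hσ
    exact hy σ (hσ x (IntermediateField.mem_adjoin_simple_self _ x))
  have hmem (p : F[X]) : aeval x p ∈ IntermediateField.adjoin F {x} :=
    IntermediateField.algebra_adjoin_le_adjoin F {x} (aeval_mem_adjoin_singleton F x)
  have ht : algebraMap (RatFunc F) M RatFunc.X ∈ IntermediateField.adjoin F {x} := by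
    rw [eq_div_of_root hfg hx]
    exact div_mem (hmem f) (hmem g)
  have hr (r : RatFunc F) : algebraMap (RatFunc F) M r ∈ IntermediateField.adjoin F {x} := by
    have hp (p : F[X]) :
        algebraMap (RatFunc F) M (algebraMap F[X] (RatFunc F) p) ∈
          IntermediateField.adjoin F {x} := by
      induction p using Polynomial.induction_on with
      | C a =>
        have := IsScalarTower.algebraMap_apply F (RatFunc F) M a
        have h2 := (IntermediateField.adjoin F {x}).algebraMap_mem a
        rw [this] at h2
        exact h2
      | add p q hp hq =>
        rw [map_add, map_add]
        exact add_mem hp hq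
      | monomial n a h =>
        rw [pow_succ, ← mul_assoc, map_mul, map_mul, RatFunc.algebraMap_X]
        exact mul_mem h ht
    rw [← RatFunc.num_div_denom r, map_div₀]
    exact div_mem (hp _) (hp _)
  clear hy
  induction h1 using IntermediateField.adjoin_induction with
  | mem z hz =>
    rw [Set.mem_singleton_iff.1 hz]
    exact IntermediateField.mem_adjoin_simple_self F x
  | algebraMap r => exact hr r
  | add _ _ _ _ h1 h2 => exact add_mem h1 h2
  | inv _ _ h => exact inv_mem h
  | mul _ _ _ _ h1 h2 => exact mul_mem h1 h2

end splitting

theorem max_natDegree_eq_zero_of_C_mul_eq {F : Type} [Field F] {f g : F[X]} (hfg : IsCoprime f g)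
    {a b : F} (ha : a ≠ 0) (h : C a * g = C b * f) : max f.natDegree g.natDegree = 0 := by
  have hf : f.natDegree = 0 := natDegree_eq_zero_of_isUnit <|
    isUnit_of_dvd_unit (hfg.dvd_of_dvd_mul_right ⟨C b, h.trans (mul_comm _ _)⟩)
      (isUnit_C.2 ha.isUnit)
  have hg : g.natDegree = (C b * f).natDegree := by rw [← h, natDegree_C_mul ha]
  have := natDegree_C_mul_le b f
  omega

section converse

variable {F : Type} [Field F] {M : Type} [Field M] [Algebra F M]
  [Algebra (RatFunc F) M] [IsScalarTower F (RatFunc F) M] {f g : F[X]}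

theorem exists_finset_of_frobeniusCoset (F M : Type) [Field F] [Fintype F] [Field M] [Algebra F M]
    [Algebra (RatFunc F) M] [IsScalarTower F (RatFunc F) M] [FiniteDimensional (RatFunc F) M] :
    ∃ T : Finset M, (∀ σ : M ≃ₐ[RatFunc F] M, ∀ c ∈ T, σ c ∈ T) ∧ (∀ c ∈ T, IsAlgebraic F c) ∧
      ∀ σ : M ≃ₐ[RatFunc F] M, (∀ c ∈ T, σ c = c ^ Fintype.card F) → σ ∈ frobeniusCoset F M := by
  classical
  have h (σ : M ≃ₐ[RatFunc F] M) : ∃ c : M, IsAlgebraic F c ∧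
      (σ c = c ^ Fintype.card F → σ ∈ frobeniusCoset F M) := by
    by_cases hσ : σ ∈ frobeniusCoset F M
    · exact ⟨0, isAlgebraic_zero, fun _ => hσ⟩
    · have h1 : ¬ ∀ c : M, IsAlgebraic F c → σ c = c ^ Fintype.card F := hσ
      push Not at h1
      obtain ⟨c, hc, hne⟩ := h1
      exact ⟨c, hc, fun h => absurd h hne⟩
  choose c hc hcσ using h
  have : Fintype (M ≃ₐ[RatFunc F] M) := Fintype.ofFinite _
  refine ⟨Finset.univ.image fun τσ : (M ≃ₐ[RatFunc F] M) × (M ≃ₐ[RatFunc F] M) => τσ.1 (c τσ.2),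
    ?_, ?_, ?_⟩
  · intro σ y hy
    obtain ⟨⟨τ, ρ⟩, -, rfl⟩ := Finset.mem_image.1 hy
    exact Finset.mem_image.2 ⟨(σ * τ, ρ), Finset.mem_univ _, rfl⟩
  · intro y hy
    obtain ⟨⟨τ, ρ⟩, -, rfl⟩ := Finset.mem_image.1 hy
    exact (hc ρ).algHom (τ.toAlgHom.restrictScalars F)
  · intro σ hσ
    exact hcσ σ (hσ _ (Finset.mem_image.2 ⟨(1, σ), Finset.mem_univ _, rfl⟩))

/-- If two distinct rational points lie in the same fibre, then some element of the Frobenius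
coset fixes two distinct roots. -/
theorem exists_two_fixed_of_evalProj_eq [Fintype F] [IsGalois (RatFunc F) M]
    [FiniteDimensional (RatFunc F) M] (hfg : IsCoprime f g) (hsep : (fiberPoly f g).Separable)
    (hsplit : ((fiberPoly f g).map (algebraMap _ M)).Splits)
    (hn : 0 < max f.natDegree g.natDegree) (hq : max f.natDegree g.natDegree < Fintype.card F)
    {P Q : Option F} (hPQ : P ≠ Q)
    (hP : evalProj (max f.natDegree g.natDegree) f P ≠ 0 ∨
      evalProj (max f.natDegree g.natDegree) g P ≠ 0) {κ : F}
    (hf : evalProj (max f.natDegree g.natDegree) f Q =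
      κ * evalProj (max f.natDegree g.natDegree) f P)
    (hg : evalProj (max f.natDegree g.natDegree) g Q =
      κ * evalProj (max f.natDegree g.natDegree) g P) :
    ∃ σ ∈ frobeniusCoset F M, ∃ x y : M, x ≠ y ∧ aeval x (fiberPoly f g) = 0 ∧
      aeval y (fiberPoly f g) = 0 ∧ σ x = x ∧ σ y = y := by
  classical
  set n := max f.natDegree g.natDegree with hn_def
  set A := evalProj n f P with hA
  set B := evalProj n g P with hB
  set t := algebraMap (RatFunc F) M RatFunc.X with ht
  have hfn : f.natDegree ≤ n := le_max_left _ _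
  have hgn : g.natDegree ≤ n := le_max_right _ _
  have hnat (a b : F) : (C a * g - C b * f).natDegree ≤ n :=
    (natDegree_sub_le _ _).trans
      (max_le ((natDegree_C_mul_le _ _).trans hgn) ((natDegree_C_mul_le _ _).trans hfn))
  have hf1 : C A * g - C B * f ≠ 0 := by
    intro h0
    rcases hP with h | h
    · exact hn.ne' (max_natDegree_eq_zero_of_C_mul_eq hfg h (sub_eq_zero.1 h0))
    · rw [hn_def, max_comm] at hn
      exact hn.ne' (max_natDegree_eq_zero_of_C_mul_eq hfg.symm h (sub_eq_zero.1 h0).symm)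
  obtain ⟨c, hc⟩ : ∃ c : F, (C A * g - C B * f).eval c ≠ 0 := by
    by_contra! h
    refine hf1 (eq_zero_of_natDegree_lt_card_of_eval_eq_zero' _ Finset.univ (fun c _ => h c) ?_)
    rw [Finset.card_univ]
    exact (hnat A B).trans_lt hq
  have hc' : A * g.eval c - B * f.eval c ≠ 0 := by simpa using hc
  have hcR : f.eval c ≠ 0 ∨ g.eval c ≠ 0 := by
    by_contra! h
    simp [h.1, h.2] at hc'
  have hPc : P ≠ some c := by
    rintro rfl
    exact hc' (by simp only [hA, hB, evalProj]; ring)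
  have hQc : Q ≠ some c := by
    rintro rfl
    simp only [evalProj] at hf hg
    exact hc' (by rw [hf, hg]; ring)
  set D := algebraMap F M (f.eval c) - t * algebraMap F M (g.eval c) with hD
  have hD0 : D ≠ 0 := sub_X_mul_ne_zero hcR
  set s := (algebraMap F M A - t * algebraMap F M B) / D with hs_def
  have hsD : s * D = algebraMap F M A - t * algebraMap F M B := div_mul_cancel₀ _ hD0
  have hsG (σ : M ≃ₐ[RatFunc F] M) : σ s = s := by
    have h1 (a : F) : σ (algebraMap F M a) = algebraMap F M a :=
      (σ.toAlgHom.restrictScalars F).commutes a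
    have h2 : σ t = t := σ.commutes _
    simp only [hs_def, hD, map_div₀, map_sub, map_mul, h1, h2]
  have hs : Transcendental F s := by
    intro hs
    have h1 : t * (s * algebraMap F M (g.eval c) - algebraMap F M B) =
        s * algebraMap F M (f.eval c) - algebraMap F M A := by
      rw [hD] at hsD
      linear_combination -hsD
    have h2 : s * algebraMap F M (g.eval c) - algebraMap F M B ≠ 0 := by
      intro h2
      rw [h2, mul_zero] at h1
      apply hc'
      apply (algebraMap F M).injective
      rw [map_sub, map_mul, map_mul, map_zero]
      linear_combination algebraMap F M (g.eval c) * h1 + algebraMap F M (f.eval c) * h2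
    refine transcendental_algebraMap_X (F := F) (M := M) ?_
    rw [← ht, eq_div_of_mul_eq h2 h1, div_eq_mul_inv]
    exact ((hs.mul (isAlgebraic_algebraMap _)).sub (isAlgebraic_algebraMap _)).mul
      ((hs.mul (isAlgebraic_algebraMap _)).sub (isAlgebraic_algebraMap _)).inv
  obtain ⟨T, hT, hTalg, hTF⟩ := exists_finset_of_frobeniusCoset F M
  set R := ((fiberPoly f g).aroots M).toFinset with hR
  have hmem (x : M) : x ∈ R ↔ aeval x (fiberPoly f g) = 0 := by
    rw [hR, Multiset.mem_toFinset, mem_aroots, and_iff_right hsep.ne_zero]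
  have hcoord : Function.Injective fun x : M => (x - algebraMap F M c)⁻¹ :=
    inv_injective.comp (sub_left_injective)
  have hxc (x : M) (hx : aeval x (fiberPoly f g) = 0) : x ≠ algebraMap F M c := by
    rintro rfl
    exact transcendental_of_root hfg hx (isAlgebraic_algebraMap c)
  have hσz (σ : M ≃ₐ[RatFunc F] M) (x : M) :
      σ (x - algebraMap F M c)⁻¹ = (σ x - algebraMap F M c)⁻¹ := by
    rw [map_inv₀, map_sub]
    congr 2
    exact (σ.toAlgHom.restrictScalars F).commutes c
  have hZprod (a : F) : ∏ z ∈ R.image (fun x => (x - algebraMap F M c)⁻¹), (algebraMap F M a - z) =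
      ∏ x ∈ R, (algebraMap F M a - (x - algebraMap F M c)⁻¹) :=
    Finset.prod_image hcoord.injOn
  obtain ⟨σ, hσT, z, hz, w, hw, hzw, hσz', hσw⟩ :=
    exists_two_fixed_of_prod_eq_mul (G := M ≃ₐ[RatFunc F] M) hs hsG
    (Z := R.image fun x => (x - algebraMap F M c)⁻¹) (T := T) (a := invCoord c P)
    (b := invCoord c Q) (by
      intro σ z hz
      obtain ⟨x, hx, rfl⟩ := Finset.mem_image.1 hz
      refine Finset.mem_image.2 ⟨σ x, ?_, (hσz σ x).symm⟩
      rw [hmem] at hx ⊢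
      rw [aeval_algEquiv, AlgHom.comp_apply, hx]
      exact map_zero _) hT hTalg (by
      intro z hz
      obtain ⟨x, hx, rfl⟩ := Finset.mem_image.1 hz
      rw [hmem] at hx
      have hgx := aeval_ne_zero_of_root hfg hx
      have htx : t * aeval x g = aeval x f := by
        rw [ht, eq_div_of_root hfg hx, div_mul_cancel₀ _ hgx]
      refine isIntegralElem_inv_sub (p := C A * g - C B * f)
        (r := C (f.eval c) * g - C (g.eval c) * f) (hnat _ _) (hnat _ _) hc ?_ (hxc x hx) ?_
      · simp [mul_comm]
      · rw [map_sub, map_sub, map_mul, map_mul, map_mul, map_mul, aeval_C, aeval_C, aeval_C,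
          aeval_C, ← htx]
        rw [hD] at hsD
        linear_combination -aeval x g * hsD) (by
      intro z hz y hy
      obtain ⟨x, hx, rfl⟩ := Finset.mem_image.1 hz
      rw [hmem] at hx
      have h1 := mem_adjoin_of_forall_fixed hfg hx (y := y) fun σ hσ => hy σ (by
        change σ _ = _
        rw [hσz, hσ])
      refine IntermediateField.adjoin_le_iff.2 (Set.singleton_subset_iff.2 ?_) h1
      have h2 := inv_mem (IntermediateField.mem_adjoin_simple_self F (x - algebraMap F M c)⁻¹)
      rw [inv_inv] at h2
      have h3 := add_mem h2 (IntermediateField.algebraMap_mem _ c)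
      rwa [sub_add_cancel] at h3)
    (fun h => hPQ (invCoord_injOn c hPc hQc h)) (by
      obtain ⟨e, he⟩ := prod_invCoord_sub hsep hsplit hfg hn hPc
      exact ⟨e, (hZprod _).trans he⟩) (by
      obtain ⟨e, he⟩ := prod_invCoord_sub hsep hsplit hfg hn hQc
      refine ⟨κ * e, (hZprod _).trans (he.trans ?_)⟩
      rw [hf, hg, map_mul, map_mul, map_mul, hs_def]
      ring)
  obtain ⟨x, hx, rfl⟩ := Finset.mem_image.1 hz
  obtain ⟨y, hy, rfl⟩ := Finset.mem_image.1 hw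
  refine ⟨σ, hTF σ hσT, x, y, fun h => hzw (by rw [h]), (hmem x).1 hx, (hmem y).1 hy, ?_, ?_⟩
  · exact hcoord ((hσz σ x).symm.trans hσz')
  · exact hcoord ((hσz σ y).symm.trans hσw)

end converse

section ratEval

variable {F : Type} [Field F] {f g : F[X]}

theorem evalProj_ne_zero (hfg : IsCoprime f g) (hn : 0 < max f.natDegree g.natDegree)
    (P : Option F) : evalProj (max f.natDegree g.natDegree) f P ≠ 0 ∨
      evalProj (max f.natDegree g.natDegree) g P ≠ 0 := by
  by_contra! h
  rcases P with _ | a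
  · obtain ⟨h1, h2⟩ := h
    simp only [evalProj] at h1 h2
    rcases le_total f.natDegree g.natDegree with h | h
    · rw [max_eq_right h] at h2 hn
      rw [leadingCoeff_eq_zero.1 h2] at hn
      simp at hn
    · rw [max_eq_left h] at h1 hn
      rw [leadingCoeff_eq_zero.1 h1] at hn
      simp at hn
  · obtain ⟨u, v, huv⟩ := hfg
    have := congrArg (eval a) huv
    simp only [evalProj] at h
    simp [h.1, h.2] at this

theorem ratEval_eq (hn : 0 < max f.natDegree g.natDegree) (P : Option F) :
    (evalProj (max f.natDegree g.natDegree) g P = 0 ∧ ratEval f g P = none) ∨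
    (evalProj (max f.natDegree g.natDegree) g P ≠ 0 ∧ ratEval f g P =
      some (evalProj (max f.natDegree g.natDegree) f P /
        evalProj (max f.natDegree g.natDegree) g P)) := by
  rcases P with _ | a
  · simp only [evalProj, ratEval]
    rcases lt_trichotomy f.natDegree g.natDegree with h | h | h
    · right
      have hg : g ≠ 0 := by rintro rfl; simp at h
      rw [max_eq_right h.le, if_neg h.not_gt, if_pos h, coeff_eq_zero_of_natDegree_lt h, zero_div]
      exact ⟨leadingCoeff_ne_zero.2 hg, rfl⟩
    · right
      have hg : g ≠ 0 := by rintro rfl; simp [h] at hn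
      rw [if_neg h.not_gt, if_neg h.not_lt, h, max_self]
      refine ⟨leadingCoeff_ne_zero.2 hg, ?_⟩
      rw [leadingCoeff, leadingCoeff, h]
    · left
      rw [max_eq_left h.le, if_pos h]
      exact ⟨coeff_eq_zero_of_natDegree_lt h, rfl⟩
  · by_cases h : g.eval a = 0
    · exact Or.inl ⟨h, if_neg (not_not.2 h)⟩
    · exact Or.inr ⟨h, if_pos h⟩

theorem exists_evalProj_eq_mul (hfg : IsCoprime f g) (hn : 0 < max f.natDegree g.natDegree)
    {P Q : Option F} (h : ratEval f g P = ratEval f g Q) :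
    ∃ κ : F, evalProj (max f.natDegree g.natDegree) f Q =
        κ * evalProj (max f.natDegree g.natDegree) f P ∧
      evalProj (max f.natDegree g.natDegree) g Q =
        κ * evalProj (max f.natDegree g.natDegree) g P := by
  rcases ratEval_eq hn P with ⟨hP, hP'⟩ | ⟨hP, hP'⟩ <;>
    rcases ratEval_eq hn Q with ⟨hQ, hQ'⟩ | ⟨hQ, hQ'⟩ <;> rw [hP', hQ'] at h
  · have := (evalProj_ne_zero hfg hn P).resolve_right (not_not.2 hP)
    exact ⟨_, (div_mul_cancel₀ _ this).symm, by rw [hP, hQ, mul_zero]⟩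
  · cases h
  · cases h
  · refine ⟨_, ?_, (div_mul_cancel₀ _ hP).symm⟩
    have h1 := Option.some_injective _ h
    rw [div_eq_div_iff hP hQ] at h1
    rw [div_mul_eq_mul_div, eq_div_iff hP]
    linear_combination -h1

theorem eq_of_ratEval_injective (hfg : IsCoprime f g) (h : Function.Injective (ratEval f g))
    (a b : F) (hab : g.eval a * f.eval b = f.eval a * g.eval b) : a = b := by
  have hne (c : F) : f.eval c ≠ 0 ∨ g.eval c ≠ 0 := by
    by_contra! h
    obtain ⟨u, v, huv⟩ := hfg
    have := congrArg (eval c) huv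
    simp [h.1, h.2] at this
  refine Option.some_injective _ (h ?_)
  simp only [ratEval]
  by_cases ha : g.eval a = 0
  · have hb : g.eval b = 0 := by
      rw [ha, zero_mul, zero_eq_mul] at hab
      exact hab.resolve_left ((hne a).resolve_right (not_not.2 ha))
    rw [if_neg (not_not.2 ha), if_neg (not_not.2 hb)]
  · have hb : g.eval b ≠ 0 := by
      intro hb
      rw [hb, mul_zero, mul_eq_zero] at hab
      exact (hne b).elim (fun h => hab.elim ha h) fun h => h hb
    rw [if_pos ha, if_pos hb]
    congr 1
    rw [div_eq_div_iff ha hb]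
    linear_combination -hab

end ratEval

theorem isConstantElem_iff {F : Type} [Field F] {f g : F[X]}
    {x : (fiberPoly f g).SplittingField} : isConstantElem f g x ↔ IsAlgebraic F x := by
  rw [isConstantElem, ← IsScalarTower.algebraMap_eq]
  rfl

theorem derivative_ne_zero_or {F : Type} [Field F] {p : ℕ} [CharP F p] (hp : p ≠ 0) {f g : F[X]}
    (h : ¬ ((∃ f₀, expand F p f₀ = f) ∧ (∃ g₀, expand F p g₀ = g))) :
    derivative f ≠ 0 ∨ derivative g ≠ 0 := by
  by_contra! h0
  exact h ⟨⟨_, expand_contract p h0.1 hp⟩, ⟨_, expand_contract p h0.2 hp⟩⟩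

theorem ratEval_bijective_iff {F : Type} [Field F] [Fintype F] {f g : F[X]} (hfg : IsCoprime f g)
    (hd : derivative f ≠ 0 ∨ derivative g ≠ 0)
    (hq : injectiveBound (max f.natDegree g.natDegree) ≤ Fintype.card F)
    (hq' : max f.natDegree g.natDegree < Fintype.card F) :
    Function.Bijective (ratEval f g) ↔
      ∀ σ ∈ frobeniusCoset F (fiberPoly f g).SplittingField,
        ∃! x, x ∈ (fiberPoly f g).rootSet (fiberPoly f g).SplittingField ∧ σ x = x := by
  have hn : 0 < max f.natDegree g.natDegree := by
    rw [lt_max_iff]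
    refine hd.imp (fun h => ?_) fun h => ?_ <;>
    · refine Nat.pos_of_ne_zero fun h0 => h ?_
      rw [eq_C_of_natDegree_eq_zero h0, derivative_C]
  have hsep := separable_fiberPoly hfg hd
  have hsplit := SplittingField.splits (fiberPoly f g)
  have : IsGalois (RatFunc F) (fiberPoly f g).SplittingField :=
    IsGalois.of_separable_splitting_field hsep
  rw [← Finite.injective_iff_bijective]
  refine ⟨fun h σ hσ => existsUnique_fixed_of_injective hfg hd hn hsplit
    (eq_of_ratEval_injective hfg h) hq hσ, fun h P Q hPQ => ?_⟩
  by_contra hne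
  obtain ⟨κ, hκf, hκg⟩ := exists_evalProj_eq_mul hfg hn hPQ
  obtain ⟨σ, hσ, x, y, hxy, hx, hy, hσx, hσy⟩ :=
    exists_two_fixed_of_evalProj_eq (M := (fiberPoly f g).SplittingField) hfg hsep hsplit hn hq' hne
      (evalProj_ne_zero hfg hn P) hκf hκg
  exact hxy ((h σ hσ).unique ⟨mem_rootSet.2 ⟨hsep.ne_zero, hx⟩, hσx⟩
    ⟨mem_rootSet.2 ⟨hsep.ne_zero, hy⟩, hσy⟩)

theorem stmt_0 :
    ∃ C : ℕ → ℕ → ℕ,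
      ∀ (p ℓ : ℕ) (F : Type) [Field F] [Fintype F],
        p.Prime → 0 < ℓ → Fintype.card F = p ^ ℓ →
        ∀ f g : F[X], IsCoprime f g →
          ¬ ((∃ f₀, Polynomial.expand F p f₀ = f) ∧ (∃ g₀, Polynomial.expand F p g₀ = g)) →
          ∀ γ : (fiberPoly f g).SplittingField ≃ₐ[RatFunc F] (fiberPoly f g).SplittingField,
            (∀ x, isConstantElem f g x → γ x = x ^ Fintype.card F) →
            C f.natDegree g.natDegree ≤ Fintype.card F →
            (Function.Bijective (ratEval f g) ↔
              ∀ σ : (fiberPoly f g).SplittingField ≃ₐ[RatFunc F] (fiberPoly f g).SplittingField,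
                (∀ x, isConstantElem f g x → σ x = γ x) →
                ∃! x, x ∈ (fiberPoly f g).rootSet (fiberPoly f g).SplittingField ∧ σ x = x) := by
  refine ⟨fun a b => max (injectiveBound (max a b)) (max a b + 1), ?_⟩
  intro p ℓ F _ _ hp hℓ hcard f g hfg hnot γ hγ hC
  have : Fact p.Prime := ⟨hp⟩
  have : CharP F p := charP_of_card_eq_prime_pow hcard
  rw [ratEval_bijective_iff hfg (derivative_ne_zero_or hp.ne_zero hnot)
    ((le_max_left _ _).trans hC) ((le_max_right _ _).trans hC)]
  refine forall_congr' fun σ => imp_congr_left ?_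
  refine forall_congr' fun x => ?_
  rw [isConstantElem_iff]
  exact forall_congr' fun hx => by rw [hγ x (isConstantElem_iff.2 hx)]

end
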